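/- Let d ≥ 1, ζ > 0, and σ = ζ·d^{−1/4}. Then the locally balanced ideal Metropolis–Hastings kernel P_∞ satisfies Φ(P_∞) ≥ 2^{−9/2}·exp(−ζ⁴/8)·√( ζ²·d^{−1/2}·(2 + ζ²·d^{−1/2}) )·c_γ and γ(P_∞) ≥ 2^{−10}·exp(−ζ⁴/4)·ζ²·d^{−1/2}·(2 + ζ²·d^{−1/2})·c_γ², where c_γ := 0.3177765. -/

import Mathlib

open MeasureTheory ENNReal

noncomputable section

/-- `ℝ^d` with the Euclidean norm and Lebesgue measure. -/
abbrev Ed (d : ℕ) := EuclideanSpace ℝ (Fin d)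

variable {d : ℕ}

/-- The standard Gaussian density on `ℝ^d`. -/
def stdGauss (d : ℕ) (x : Ed d) : ℝ :=
  (2 * Real.pi) ^ (-(d : ℝ) / 2) * Real.exp (-‖x‖ ^ 2 / 2)

/-- The locally balanced reweighted proposal density: the density at `y` of
`N(2x/(2+σ²), (2σ²/(2+σ²))·I_d)`. -/
def lbProp (σ : ℝ) (x y : Ed d) : ℝ :=
  (2 * Real.pi * (2 * σ ^ 2 / (2 + σ ^ 2))) ^ (-(d : ℝ) / 2) *
    Real.exp (-‖y - (2 / (2 + σ ^ 2)) • x‖ ^ 2 / (2 * (2 * σ ^ 2 / (2 + σ ^ 2))))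

/-- The acceptance probability `α(x,y) = min{1, π(y) g(y,x)/(π(x) g(x,y))}`. -/
def lbAcc (d : ℕ) (σ : ℝ) (x y : Ed d) : ℝ :=
  min 1 (stdGauss d y * lbProp σ y x / (stdGauss d x * lbProp σ x y))

/-- The probability measure with standard Gaussian density. -/
def piMeasure (d : ℕ) : Measure (Ed d) :=
  volume.withDensity fun x => ENNReal.ofReal (stdGauss d x)

/-- The Dirichlet form of the locally balanced ideal kernel `P_∞`:
`ℰ(P_∞,f) = (1/2)∫∫ (f(x) - f(y))² α(x,y) g(x,y) π(x) dy dx`. -/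
def lbDirichlet (d : ℕ) (σ : ℝ) (f : Ed d → ℝ) : ℝ≥0∞ :=
  (1 / 2 : ℝ≥0∞) * ∫⁻ x, ∫⁻ y,
    ENNReal.ofReal ((f x - f y) ^ 2 * lbAcc d σ x y * lbProp σ x y * stdGauss d x)

/-- The spectral gap `γ(P_∞)` of the locally balanced ideal kernel. -/
def lbGap (d : ℕ) (σ : ℝ) : ℝ≥0∞ :=
  ⨅ (f : Ed d → ℝ) (_ : Measurable f ∧
      0 < (∫⁻ x, ENNReal.ofReal (f x ^ 2) ∂piMeasure d) ∧
      (∫⁻ x, ENNReal.ofReal (f x ^ 2) ∂piMeasure d) < ∞ ∧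
      (∫ x, f x ∂piMeasure d) = 0),
    lbDirichlet d σ f / ∫⁻ x, ENNReal.ofReal (f x ^ 2) ∂piMeasure d

/-- The conductance `Φ(P_∞)` of the locally balanced ideal kernel. -/
def lbConductance (d : ℕ) (σ : ℝ) : ℝ≥0∞ :=
  ⨅ (A : Set (Ed d)) (_ : MeasurableSet A ∧
      0 < (∫⁻ x in A, ENNReal.ofReal (stdGauss d x)) ∧
      (∫⁻ x in A, ENNReal.ofReal (stdGauss d x)) ≤ 1 / 2),
    (∫⁻ x in A, ∫⁻ y in Aᶜ, ENNReal.ofReal (lbAcc d σ x y * lbProp σ x y * stdGauss d x)) /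
      ∫⁻ x in A, ENNReal.ofReal (stdGauss d x)

open Real ProbabilityTheory Filter Topology
open scoped RealInnerProductSpace

/-- The density at `y` of the Gaussian `N(c, w·I_d)`. -/
def gaussDens (w : ℝ) (c y : Ed d) : ℝ :=
  (2 * π * w) ^ (-(d : ℝ) / 2) * exp (-‖y - c‖ ^ 2 / (2 * w))

lemma gaussDens_pos {w : ℝ} (hw : 0 < w) (c y : Ed d) : 0 < gaussDens w c y := by
  unfold gaussDens; positivity

lemma integral_gaussDens {w : ℝ} (hw : 0 < w) (c : Ed d) : ∫ y, gaussDens w c y = 1 := by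
  have h1 : ∫ y : Ed d, exp (-‖y - c‖ ^ 2 / (2 * w)) = (2 * π * w) ^ ((d : ℝ) / 2) := by
    rw [integral_sub_right_eq_self (fun y : Ed d => exp (-‖y‖ ^ 2 / (2 * w))) c]
    have h := GaussianFourier.integral_rexp_neg_mul_sq_norm (V := Ed d)
      (b := (2 * w)⁻¹) (by positivity)
    rw [finrank_euclideanSpace_fin] at h
    rw [show π / (2 * w)⁻¹ = 2 * π * w by rw [div_inv_eq_mul]; ring] at h
    rw [← h]
    congr 1
    ext y
    congr 1
    ring
  simp only [gaussDens]
  rw [integral_const_mul, h1, ← Real.rpow_add (by positivity)]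
  simp [neg_div]

lemma integrable_gaussDens {w : ℝ} (hw : 0 < w) (c : Ed d) : Integrable (gaussDens w c) :=
  .of_integral_ne_zero (by rw [integral_gaussDens hw]; exact one_ne_zero)

lemma stdGauss_eq_gaussDens (x : Ed d) : stdGauss d x = gaussDens 1 0 x := by
  simp [stdGauss, gaussDens]

lemma stdGauss_pos (x : Ed d) : 0 < stdGauss d x := by
  rw [stdGauss_eq_gaussDens]; exact gaussDens_pos one_pos _ _

lemma continuous_stdGauss : Continuous (stdGauss d) := by
  unfold stdGauss; fun_prop

lemma integrable_stdGauss : Integrable (stdGauss d) := by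
  rw [show stdGauss d = gaussDens 1 0 from funext stdGauss_eq_gaussDens]
  exact integrable_gaussDens one_pos (0 : Ed d)

instance isProbabilityMeasure_piMeasure : IsProbabilityMeasure (piMeasure d) := by
  constructor
  rw [piMeasure, withDensity_apply _ .univ, Measure.restrict_univ,
    ← ofReal_integral_eq_lintegral_ofReal integrable_stdGauss
      (ae_of_all _ fun x => (stdGauss_pos x).le)]
  simp only [stdGauss_eq_gaussDens]
  simp [integral_gaussDens]

lemma integral_piMeasure {F : Type*} [NormedAddCommGroup F] [NormedSpace ℝ F] (f : Ed d → F) :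
    ∫ x, f x ∂piMeasure d = ∫ x, stdGauss d x • f x := by
  rw [piMeasure, integral_withDensity_eq_integral_toReal_smul
    (continuous_stdGauss.measurable.ennreal_ofReal) (ae_of_all _ fun _ => ofReal_lt_top)]
  simp only [toReal_ofReal (stdGauss_pos _).le]

lemma piMeasure_eq_stdGaussian : piMeasure d = stdGaussian (Ed d) := by
  refine Measure.ext_of_charFun (funext fun t => ?_)
  rw [charFun_stdGaussian, charFun_apply, integral_piMeasure]
  have h := GaussianFourier.integral_cexp_neg_mul_sq_norm_add (V := Ed d) (b := (1 / 2 : ℂ))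
    (by norm_num) Complex.I t
  rw [finrank_euclideanSpace_fin] at h
  have h2 : ∀ x : Ed d, stdGauss d x • Complex.exp (⟪x, t⟫ * Complex.I) =
      (((2 * π) ^ (-(d : ℝ) / 2) : ℝ) : ℂ) *
        Complex.exp (-(1 / 2 : ℂ) * ‖x‖ ^ 2 + Complex.I * ⟪t, x⟫) := by
    intro x
    rw [stdGauss, Complex.real_smul, Complex.ofReal_mul, mul_assoc, Complex.ofReal_exp,
      ← Complex.exp_add, real_inner_comm]
    congr 2
    push_cast
    ring
  simp_rw [h2]
  rw [integral_const_mul, h, ← mul_assoc]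
  have h3 : (((2 * π) ^ (-(d : ℝ) / 2) : ℝ) : ℂ) * ((π : ℂ) / (1 / 2)) ^ ((d : ℂ) / 2) = 1 := by
    have : ((π : ℂ) / (1 / 2)) ^ ((d : ℂ) / 2) = (((2 * π) ^ ((d : ℝ) / 2) : ℝ) : ℂ) := by
      rw [Complex.ofReal_cpow (by positivity)]
      push_cast
      congr 1
      ring
    rw [this, ← Complex.ofReal_mul, ← Real.rpow_add (by positivity)]
    simp [neg_div]
  rw [h3, one_mul]
  congr 1
  simp
  ring

lemma map_rotation_piMeasure (θ : ℝ) :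
    ((piMeasure d).prod (piMeasure d)).map (ContinuousLinearMap.rotation θ) =
      (piMeasure d).prod (piMeasure d) := by
  rw [piMeasure_eq_stdGaussian]
  exact IsGaussian.map_rotation_eq_self (by simp) θ

lemma integrable_sq_piMeasure (L : StrongDual ℝ (Ed d)) :
    Integrable (fun x => L x ^ 2) (piMeasure d) := by
  rw [piMeasure_eq_stdGaussian]
  exact (IsGaussian.memLp_dual _ L 2 (by simp)).integrable_sq

lemma integral_sq_piMeasure (L : StrongDual ℝ (Ed d)) :
    ∫ x, L x ^ 2 ∂piMeasure d = ‖L‖ ^ 2 := by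
  have h := variance_dual_stdGaussian L
  rw [variance_of_integral_eq_zero (by fun_prop) (integral_strongDual_stdGaussian L)] at h
  rw [piMeasure_eq_stdGaussian, h]

lemma integrable_norm_piMeasure : Integrable (fun x : Ed d => ‖x‖) (piMeasure d) := by
  rw [piMeasure_eq_stdGaussian]
  exact IsGaussian.integrable_id.norm

lemma integral_abs_piMeasure_le (L : StrongDual ℝ (Ed d)) :
    ∫ x, |L x| ∂piMeasure d ≤ ‖L‖ := by
  rcases eq_or_ne L 0 with rfl | hL
  · simp
  have hL : 0 < ‖L‖ := norm_pos_iff.2 hL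
  have h : ∫ x, |L x| ∂piMeasure d ≤ ∫ x, (L x ^ 2 * (2 * ‖L‖)⁻¹ + ‖L‖ / 2) ∂piMeasure d := by
    refine integral_mono_of_nonneg (ae_of_all _ fun _ => abs_nonneg _)
      (((integrable_sq_piMeasure L).mul_const _).add (integrable_const _))
      (ae_of_all _ fun x => ?_)
    have h1 : |L x| ^ 2 = L x ^ 2 := sq_abs _
    have h2 : L x ^ 2 * (2 * ‖L‖)⁻¹ + ‖L‖ / 2 - |L x| = (|L x| - ‖L‖) ^ 2 / (2 * ‖L‖) := by
      rw [← h1]; field_simp; ring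
    have h3 : 0 ≤ (|L x| - ‖L‖) ^ 2 / (2 * ‖L‖) := by positivity
    simp only
    linarith
  refine h.trans (le_of_eq ?_)
  rw [integral_add ((integrable_sq_piMeasure L).mul_const _) (integrable_const _),
    integral_mul_const, integral_sq_piMeasure, integral_const]
  simp
  field_simp
  ring

lemma gaussDens_affine {w : ℝ} (hw : 0 < w) (c z : Ed d) :
    gaussDens w c (c + √w • z) = (√w ^ d)⁻¹ * stdGauss d z := by
  have h : (w : ℝ) ^ (-(d : ℝ) / 2) = (√w ^ d)⁻¹ := by
    rw [neg_div, rpow_neg hw.le, ← rpow_natCast (√w) d, sqrt_eq_rpow, ← rpow_mul hw.le]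
    congr 2
    ring
  have h2 : ‖c + √w • z - c‖ ^ 2 = w * ‖z‖ ^ 2 := by
    rw [add_sub_cancel_left, norm_smul, mul_pow, norm_of_nonneg (sqrt_nonneg w), sq_sqrt hw.le]
  rw [gaussDens, stdGauss, h2, mul_rpow (by positivity) hw.le, h]
  have : -(w * ‖z‖ ^ 2) / (2 * w) = -‖z‖ ^ 2 / 2 := by field_simp
  rw [this]
  ring

lemma integral_affine {w : ℝ} (hw : 0 < w) (c : Ed d) (F : Ed d → ℝ) :
    ∫ y, F y = √w ^ d * ∫ z, F (c + √w • z) := by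
  have hs : 0 < √w := sqrt_pos.2 hw
  rw [Measure.integral_comp_smul volume (fun z => F (c + z)), integral_add_left_eq_self,
    finrank_euclideanSpace_fin, smul_eq_mul, abs_of_pos (by positivity)]
  field_simp

lemma integral_gaussDens_mul_inner_sq {w : ℝ} (hw : 0 < w) (c e : Ed d) :
    ∫ y, gaussDens w c y * ⟪e, y - c⟫ ^ 2 = w * ‖e‖ ^ 2 := by
  have hs : 0 < √w := sqrt_pos.2 hw
  have h := integral_sq_piMeasure (innerSL ℝ e)
  rw [integral_piMeasure, innerSL_apply_norm] at h
  rw [integral_affine hw c, ← h, ← integral_const_mul, ← integral_const_mul]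
  congr 1
  ext z
  rw [gaussDens_affine hw, add_sub_cancel_left, inner_smul_right, mul_pow, sq_sqrt hw.le]
  simp only [innerSL_apply_apply, smul_eq_mul]
  field_simp

lemma integrable_gaussDens_mul_inner_sq {w : ℝ} (hw : 0 < w) (c e : Ed d) :
    Integrable fun y => gaussDens w c y * ⟪e, y - c⟫ ^ 2 := by
  rcases eq_or_ne e 0 with rfl | he
  · simp
  · refine .of_integral_ne_zero ?_
    rw [integral_gaussDens_mul_inner_sq hw]
    have := norm_pos_iff.2 he
    positivity

/-- The mean variation of `h` along a rotation by the angle `θ`. -/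
def rotVar (h : Ed d → ℝ) (θ : ℝ) : ℝ :=
  ∫ p : Ed d × Ed d, |h p.1 - h (cos θ • p.1 + sin θ • p.2)| ∂(piMeasure d).prod (piMeasure d)

lemma integrable_rot_norm (a b : ℝ) :
    Integrable (fun p : Ed d × Ed d => a * ‖p.1‖ + b * ‖p.2‖)
      ((piMeasure d).prod (piMeasure d)) :=
  (integrable_norm_piMeasure.comp_fst _ |>.const_mul a).add
    (integrable_norm_piMeasure.comp_snd _ |>.const_mul b)

lemma integrable_rot_sub {h : Ed d → ℝ} {L : NNReal} (hL : LipschitzWith L h) (s t : ℝ) :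
    Integrable (fun p : Ed d × Ed d => |h (cos s • p.1 + sin s • p.2) -
      h (cos t • p.1 + sin t • p.2)|) ((piMeasure d).prod (piMeasure d)) := by
  refine Integrable.mono' (integrable_rot_norm (L * |cos s - cos t|) (L * |sin s - sin t|))
    (Continuous.aestronglyMeasurable (by have := hL.continuous; fun_prop))
    (ae_of_all _ fun p => ?_)
  rw [norm_of_nonneg (abs_nonneg _), ← norm_eq_abs]
  refine (hL.norm_sub_le _ _).trans ?_
  have : cos s • p.1 + sin s • p.2 - (cos t • p.1 + sin t • p.2) =
      (cos s - cos t) • p.1 + (sin s - sin t) • p.2 := by module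
  rw [this, mul_assoc, mul_assoc, ← mul_add]
  gcongr
  refine (norm_add_le _ _).trans (le_of_eq ?_)
  simp [norm_smul]

lemma integral_rot_step {h : Ed d → ℝ} {L : NNReal} (hL : LipschitzWith L h) (s θ : ℝ) :
    ∫ p : Ed d × Ed d, |h (cos s • p.1 + sin s • p.2) -
      h (cos (s + θ) • p.1 + sin (s + θ) • p.2)| ∂(piMeasure d).prod (piMeasure d) =
      rotVar h θ := by
  rw [rotVar]
  conv_rhs => rw [← map_rotation_piMeasure s]
  rw [integral_map (ContinuousLinearMap.measurable _).aemeasurable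
    (Continuous.aestronglyMeasurable (by have := hL.continuous; fun_prop))]
  congr 1
  ext p
  simp only [ContinuousLinearMap.rotation_apply]
  congr 3
  rw [cos_add, sin_add]
  module

lemma rotVar_pi_div_two_le {h : Ed d → ℝ} {L : NNReal} (hL : LipschitzWith L h) (N : ℕ) :
    rotVar h (π / 2) ≤ (N + 1) * rotVar h (π / 2 / (N + 1)) := by
  set θ := π / 2 / ((N : ℝ) + 1) with hθ
  have hN : ((N + 1 : ℕ) : ℝ) * θ = π / 2 := by rw [hθ]; push_cast; field_simp
  let X : ℕ → Ed d × Ed d → ℝ := fun i p => h (cos (i * θ) • p.1 + sin (i * θ) • p.2)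
  have key : ∀ p : Ed d × Ed d, |h p.1 - h (cos (π / 2) • p.1 + sin (π / 2) • p.2)| ≤
      ∑ i ∈ Finset.range (N + 1), |X i p - X (i + 1) p| := by
    intro p
    have h0 : h p.1 = X 0 p := by simp [X]
    have h1 : h (cos (π / 2) • p.1 + sin (π / 2) • p.2) = X (N + 1) p := by
      simp only [X, hN]
    rw [h0, h1, ← Finset.sum_range_sub' (fun i => X i p)]
    exact Finset.abs_sum_le_sum_abs _ _
  have hint : ∀ i : ℕ, Integrable (fun p => |X i p - X (i + 1) p|)
      ((piMeasure d).prod (piMeasure d)) := fun i => integrable_rot_sub hL _ _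
  have hval : ∀ i : ℕ, ∫ p, |X i p - X (i + 1) p| ∂(piMeasure d).prod (piMeasure d) =
      rotVar h θ := by
    intro i
    rw [← integral_rot_step hL (i * θ) θ]
    simp only [X]
    push_cast
    simp only [add_mul, one_mul]
  calc rotVar h (π / 2)
      ≤ ∫ p, ∑ i ∈ Finset.range (N + 1), |X i p - X (i + 1) p|
          ∂(piMeasure d).prod (piMeasure d) :=
        integral_mono_of_nonneg (ae_of_all _ fun _ => abs_nonneg _)
          (integrable_finsetSum _ fun i _ => hint i) (ae_of_all _ key)
    _ = (N + 1) * rotVar h θ := by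
        rw [integral_finsetSum _ fun i _ => hint i]
        simp [hval]

lemma tendsto_rotVar {h : Ed d → ℝ} {L : NNReal} (hL : LipschitzWith L h) :
    Tendsto (fun N : ℕ => ((N : ℝ) + 1) * rotVar h (π / 2 / (N + 1))) atTop
      (𝓝 (∫ p : Ed d × Ed d, π / 2 * |fderiv ℝ h p.1 p.2|
        ∂(piMeasure d).prod (piMeasure d))) := by
  simp only [rotVar, ← integral_const_mul]
  refine tendsto_integral_of_dominated_convergence
    (fun p : Ed d × Ed d => (L * (π / 2)) * ‖p.1‖ + (L * (π / 2)) * ‖p.2‖) (fun N => ?_)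
    (integrable_rot_norm _ _) (fun N => ae_of_all _ fun p => ?_) ?_
  · exact Continuous.aestronglyMeasurable (by have := hL.continuous; fun_prop)
  · set θ := π / 2 / ((N : ℝ) + 1) with hθ
    have hθ0 : 0 ≤ θ := by positivity
    have hN : ((N : ℝ) + 1) * θ = π / 2 := by rw [hθ]; field_simp
    rw [norm_of_nonneg (by positivity), ← norm_eq_abs]
    have h1 : ‖p.1 - (cos θ • p.1 + sin θ • p.2)‖ ≤ θ * ‖p.1‖ + θ * ‖p.2‖ := by
      have : p.1 - (cos θ • p.1 + sin θ • p.2) = (1 - cos θ) • p.1 - sin θ • p.2 := by module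
      rw [this]
      refine (norm_sub_le _ _).trans ?_
      rw [norm_smul, norm_smul, norm_eq_abs, norm_eq_abs]
      have hs : |sin θ| ≤ θ := (abs_sin_le_abs).trans_eq (abs_of_nonneg hθ0)
      have hc : |1 - cos θ| ≤ θ := by
        rw [abs_of_nonneg (sub_nonneg.2 (cos_le_one θ))]
        rcases le_total θ 2 with h3 | h3
        · nlinarith [one_sub_sq_div_two_le_cos (x := θ)]
        · linarith [neg_one_le_cos θ]
      gcongr
    calc ((N : ℝ) + 1) * ‖h p.1 - h (cos θ • p.1 + sin θ • p.2)‖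
        ≤ ((N : ℝ) + 1) * (L * (θ * ‖p.1‖ + θ * ‖p.2‖)) := by
          gcongr
          exact (hL.norm_sub_le _ _).trans (by gcongr)
      _ = L * (((N : ℝ) + 1) * θ) * ‖p.1‖ + L * (((N : ℝ) + 1) * θ) * ‖p.2‖ := by ring
      _ = _ := by rw [hN]
  · have hd : ∀ᵐ p : Ed d × Ed d ∂(piMeasure d).prod (piMeasure d),
        DifferentiableAt ℝ h p.1 := by
      have h1 : ∀ᵐ x ∂piMeasure d, DifferentiableAt ℝ h x :=
        (withDensity_absolutelyContinuous _ _).ae_le (hL.ae_differentiableAt (μ := volume))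
      exact Measure.quasiMeasurePreserving_fst.ae h1
    filter_upwards [hd] with p hp
    let c : ℝ → Ed d := fun t => cos t • p.1 + sin t • p.2
    have hc0 : c 0 = p.1 := by simp [c]
    have hc : HasDerivAt c p.2 0 := by
      have h1 := ((hasDerivAt_cos 0).smul_const p.1).add ((hasDerivAt_sin 0).smul_const p.2)
      rw [show (-sin 0) • p.1 + cos 0 • p.2 = p.2 by simp] at h1
      exact h1
    have hφ : HasDerivAt (fun t => h (c t)) (fderiv ℝ h p.1 p.2) 0 := by
      have h1 : HasFDerivAt h (fderiv ℝ h p.1) (c 0) := by rw [hc0]; exact hp.hasFDerivAt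
      exact h1.comp_hasDerivAt 0 hc
    have hθ : Tendsto (fun N : ℕ => π / 2 / ((N : ℝ) + 1)) atTop (𝓝[≠] 0) := by
      refine tendsto_nhdsWithin_iff.2 ⟨?_, Eventually.of_forall fun N => ?_⟩
      · simpa [div_eq_mul_inv] using
          (tendsto_one_div_add_atTop_nhds_zero_nat (𝕜 := ℝ)).const_mul (π / 2)
      · have : π / 2 / ((N : ℝ) + 1) ≠ 0 := by positivity
        exact this
    have h2 := ((hφ.tendsto_slope_zero.comp hθ).abs).const_mul (π / 2)
    refine h2.congr fun N => ?_
    simp only [Function.comp, zero_add, hc0, smul_eq_mul, abs_mul, abs_inv]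
    rw [abs_of_pos (show 0 < π / 2 / ((N : ℝ) + 1) by positivity), abs_sub_comm (h p.1)]
    field_simp
    rfl

/-- The `L¹` Poincaré (Cheeger) inequality for the standard Gaussian measure, for a Lipschitz
function that is locally constant outside `S`. -/
lemma integral_abs_sub_le_of_lipschitz {h : Ed d → ℝ} {L : NNReal} (hL : LipschitzWith L h)
    {S : Set (Ed d)} (hS : MeasurableSet S) (hd : ∀ x ∉ S, fderiv ℝ h x = 0) :
    ∫ p : Ed d × Ed d, |h p.1 - h p.2| ∂(piMeasure d).prod (piMeasure d) ≤
      π / 2 * (L * (piMeasure d).real S) := by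
  have h0 : ∫ p : Ed d × Ed d, |h p.1 - h p.2| ∂(piMeasure d).prod (piMeasure d) =
      rotVar h (π / 2) := by simp [rotVar]
  have h1 := ge_of_tendsto' (tendsto_rotVar hL) (fun N => rotVar_pi_div_two_le hL N)
  rw [h0]
  refine h1.trans ?_
  rw [integral_const_mul]
  gcongr
  have hbound : ∀ x, ‖fderiv ℝ h x‖ ≤ S.indicator (fun _ => (L : ℝ)) x := by
    intro x
    by_cases hx : x ∈ S
    · simpa [hx] using norm_fderiv_le_of_lipschitz ℝ hL
    · simp [hx, hd x hx]
  have hmeas : Measurable fun p : Ed d × Ed d => |fderiv ℝ h p.1 p.2| := by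
    have h2 : Measurable (fderiv ℝ h) := measurable_fderiv ℝ h
    have h3 : Measurable fun p : Ed d × Ed d => fderiv ℝ h p.1 p.2 :=
      (isBoundedBilinearMap_apply.continuous).measurable.comp
        ((h2.comp measurable_fst).prodMk measurable_snd)
    exact h3.abs
  have hint : Integrable (fun p : Ed d × Ed d => |fderiv ℝ h p.1 p.2|)
      ((piMeasure d).prod (piMeasure d)) := by
    refine Integrable.mono' (integrable_rot_norm 0 L) hmeas.aestronglyMeasurable
      (ae_of_all _ fun p => ?_)
    rw [norm_of_nonneg (abs_nonneg _), zero_mul, zero_add, ← norm_eq_abs]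
    exact ((fderiv ℝ h p.1).le_opNorm _).trans
      (by gcongr; exact norm_fderiv_le_of_lipschitz ℝ hL)
  rw [integral_prod _ hint]
  calc ∫ x, ∫ y, |fderiv ℝ h x y| ∂piMeasure d ∂piMeasure d
      ≤ ∫ x, S.indicator (fun _ => (L : ℝ)) x ∂piMeasure d := by
        refine integral_mono hint.integral_prod_left
          ((integrable_const _).indicator hS) fun x => ?_
        exact (integral_abs_piMeasure_le _).trans (hbound x)
    _ = L * (piMeasure d).real S := by
        rw [integral_indicator_const _ hS, smul_eq_mul, mul_comm]

lemma lbProp_eq_gaussDens (σ : ℝ) (x y : Ed d) :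
    lbProp σ x y = gaussDens (2 * σ ^ 2 / (2 + σ ^ 2)) ((2 / (2 + σ ^ 2)) • x) y := rfl

lemma lbProp_pos {σ : ℝ} (hσ : 0 < σ) (x y : Ed d) : 0 < lbProp σ x y :=
  gaussDens_pos (by positivity) _ _

lemma continuous_lbProp (σ : ℝ) : Continuous fun p : Ed d × Ed d => lbProp σ p.1 p.2 := by
  unfold lbProp; fun_prop

lemma measurable_lbAcc (σ : ℝ) : Measurable fun p : Ed d × Ed d => lbAcc d σ p.1 p.2 := by
  have h1 : Measurable fun p : Ed d × Ed d => lbProp σ p.1 p.2 := (continuous_lbProp σ).measurable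
  have h2 : Measurable fun p : Ed d × Ed d => lbProp σ p.2 p.1 :=
    ((continuous_lbProp σ).comp continuous_swap).measurable
  have h3 : Measurable fun p : Ed d × Ed d => stdGauss d p.1 :=
    (continuous_stdGauss.comp continuous_fst).measurable
  have h4 : Measurable fun p : Ed d × Ed d => stdGauss d p.2 :=
    (continuous_stdGauss.comp continuous_snd).measurable
  unfold lbAcc
  exact measurable_const.min ((h4.mul h2).div (h3.mul h1))

lemma lbAcc_nonneg {σ : ℝ} (hσ : 0 < σ) (x y : Ed d) : 0 ≤ lbAcc d σ x y :=
  le_min zero_le_one (div_nonneg (mul_nonneg (stdGauss_pos _).le (lbProp_pos hσ _ _).le)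
    (mul_nonneg (stdGauss_pos _).le (lbProp_pos hσ _ _).le))

/-- The density of the flow from `x` to `y` under the accepted moves. -/
def lbFlow (d : ℕ) (σ : ℝ) (x y : Ed d) : ℝ :=
  lbAcc d σ x y * lbProp σ x y * stdGauss d x

lemma measurable_lbFlow (σ : ℝ) : Measurable fun p : Ed d × Ed d => lbFlow d σ p.1 p.2 :=
  ((measurable_lbAcc σ).mul (continuous_lbProp σ).measurable).mul
    (continuous_stdGauss.measurable.comp measurable_fst)

lemma lbFlow_eq_min {σ : ℝ} (hσ : 0 < σ) (x y : Ed d) :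
    lbFlow d σ x y = min (stdGauss d x * lbProp σ x y) (stdGauss d y * lbProp σ y x) := by
  have h : 0 < stdGauss d x * lbProp σ x y := mul_pos (stdGauss_pos _) (lbProp_pos hσ _ _)
  rw [lbFlow, lbAcc, mul_assoc, mul_comm (lbProp σ x y), min_mul_of_nonneg _ _ h.le, one_mul,
    div_mul_cancel₀ _ h.ne']

lemma lbFlow_comm {σ : ℝ} (hσ : 0 < σ) (x y : Ed d) : lbFlow d σ x y = lbFlow d σ y x := by
  rw [lbFlow_eq_min hσ, lbFlow_eq_min hσ, min_comm]

lemma lintegral_lbFlow_le {σ : ℝ} (hσ : 0 < σ) (x : Ed d) :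
    ∫⁻ y, ENNReal.ofReal (lbFlow d σ x y) ≤ ENNReal.ofReal (stdGauss d x) := by
  calc ∫⁻ y, ENNReal.ofReal (lbFlow d σ x y)
      ≤ ∫⁻ y, ENNReal.ofReal (stdGauss d x) * ENNReal.ofReal (lbProp σ x y) := by
        refine lintegral_mono fun y => ?_
        rw [← ofReal_mul (stdGauss_pos _).le, lbFlow_eq_min hσ]
        exact ofReal_le_ofReal (min_le_left _ _)
    _ = ENNReal.ofReal (stdGauss d x) := by
        have hv : 0 < 2 * σ ^ 2 / (2 + σ ^ 2) := by positivity
        rw [lintegral_const_mul' _ _ ofReal_ne_top, ← ofReal_integral_eq_lintegral_ofReal]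
        · simp only [lbProp_eq_gaussDens]
          rw [integral_gaussDens hv]
          simp
        · exact integrable_gaussDens hv _
        · exact ae_of_all _ fun y => (lbProp_pos hσ _ _).le

lemma lbAcc_eq {σ : ℝ} (hσ : 0 < σ) (x y : Ed d) :
    lbAcc d σ x y = min 1 (exp (σ ^ 2 / (4 * (2 + σ ^ 2)) * (‖x‖ ^ 2 - ‖y‖ ^ 2))) := by
  have hc : 0 < (2 * π * (2 * σ ^ 2 / (2 + σ ^ 2))) ^ (-(d : ℝ) / 2) := by positivity
  have hc' : 0 < (2 * π) ^ (-(d : ℝ) / 2) := by positivity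
  have e1 : ‖x - (2 / (2 + σ ^ 2)) • y‖ ^ 2 =
      ‖x‖ ^ 2 - 2 * (2 / (2 + σ ^ 2)) * ⟪x, y⟫ + (2 / (2 + σ ^ 2)) ^ 2 * ‖y‖ ^ 2 := by
    rw [norm_sub_sq_real, inner_smul_right, norm_smul, mul_pow, norm_eq_abs, sq_abs]; ring
  have e2 : ‖y - (2 / (2 + σ ^ 2)) • x‖ ^ 2 =
      ‖y‖ ^ 2 - 2 * (2 / (2 + σ ^ 2)) * ⟪x, y⟫ + (2 / (2 + σ ^ 2)) ^ 2 * ‖x‖ ^ 2 := by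
    rw [norm_sub_sq_real, inner_smul_right, norm_smul, mul_pow, norm_eq_abs, sq_abs,
      real_inner_comm]; ring
  rw [lbAcc, stdGauss, stdGauss, lbProp, lbProp, e1, e2]
  congr 1
  rw [div_eq_iff (by positivity)]
  set c := (2 * π * (2 * σ ^ 2 / (2 + σ ^ 2))) ^ (-(d : ℝ) / 2)
  set c' := (2 * π) ^ (-(d : ℝ) / 2)
  have h : ∀ a b e f g : ℝ, a + b = e + f + g →
      c' * exp a * (c * exp b) = exp e * (c' * exp f * (c * exp g)) := by
    intro a b e f g habe
    have : exp a * exp b = exp e * exp f * exp g := by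
      rw [← Real.exp_add, ← Real.exp_add, ← Real.exp_add, habe]
    linear_combination c * c' * this
  apply h
  have hs : σ ≠ 0 := hσ.ne'
  field_simp
  ring

/-- The variance of the proposal tilted by the acceptance probability. -/
def tiltVar (s : ℝ) : ℝ := 2 * s * (2 + s) / ((2 + s) ^ 2 + s ^ 2)

lemma tiltVar_pos {s : ℝ} (hs : 0 < s) : 0 < tiltVar s := by unfold tiltVar; positivity

/-- The normalizing constant of the tilted proposal. -/
def tiltMass (d : ℕ) (s : ℝ) : ℝ := (1 + (s / (2 + s)) ^ 2) ^ (-(d : ℝ) / 2)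

lemma tiltMass_pos (s : ℝ) : 0 < tiltMass d s := by unfold tiltMass; positivity

lemma lbProp_mul_exp {σ : ℝ} (hσ : 0 < σ) (x y : Ed d) :
    lbProp σ x y *
        exp (-(σ ^ 2 / (4 * (2 + σ ^ 2)) * ‖y - (2 / (2 + σ ^ 2)) • x‖ ^ 2)) =
      tiltMass d (σ ^ 2) * gaussDens (tiltVar (σ ^ 2)) ((2 / (2 + σ ^ 2)) • x) y := by
  have hw := tiltVar_pos (s := σ ^ 2) (by positivity)
  rw [lbProp, gaussDens, tiltMass, mul_assoc, ← Real.exp_add, ← mul_assoc,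
    ← Real.mul_rpow (by positivity) (by positivity)]
  congr 2
  · rw [tiltVar]; field_simp
  · rw [tiltVar]; field_simp; ring

lemma norm_sq_sub_le {s : ℝ} (hs : 0 < s) (x y : Ed d) :
    s / (4 * (2 + s)) * (‖y‖ ^ 2 - ‖x‖ ^ 2) ≤
      s / (4 * (2 + s)) * ‖y - (2 / (2 + s)) • x‖ ^ 2 +
        1 / ((2 + s) * (4 + s)) * ⟪‖x‖⁻¹ • x, y - (2 / (2 + s)) • x⟫ ^ 2 := by
  set u := y - (2 / (2 + s)) • x with hu
  set e := ‖x‖⁻¹ • x with he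
  have hx : x = ‖x‖ • e := by
    rcases eq_or_ne x 0 with h | h
    · simp [h]
    · rw [he, smul_inv_smul₀ (norm_ne_zero_iff.2 h)]
  have hxu : ⟪x, u⟫ = ‖x‖ * ⟪e, u⟫ := by
    conv_lhs => rw [hx]
    rw [inner_smul_left]; rfl
  have hy : ‖y‖ ^ 2 = ‖u‖ ^ 2 + 2 * (2 / (2 + s)) * (‖x‖ * ⟪e, u⟫) +
      (2 / (2 + s)) ^ 2 * ‖x‖ ^ 2 := by
    have : y = u + (2 / (2 + s)) • x := by rw [hu]; abel
    rw [this, norm_add_sq_real, inner_smul_right, norm_smul, mul_pow, norm_eq_abs, sq_abs,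
      real_inner_comm, hxu]
    ring
  rw [hy]
  generalize ⟪e, u⟫ = t
  generalize ‖x‖ = a
  generalize ‖u‖ = b
  have key : s / (4 * (2 + s)) * b ^ 2 + 1 / ((2 + s) * (4 + s)) * t ^ 2 -
      s / (4 * (2 + s)) * (b ^ 2 + 2 * (2 / (2 + s)) * (a * t) + (2 / (2 + s)) ^ 2 * a ^ 2 - a ^ 2)
      = ((2 + s) * t * 2 - s * (4 + s) * a) ^ 2 / (4 * (2 + s) ^ 3 * (4 + s)) := by
    field_simp
    ring
  have : 0 ≤ ((2 + s) * t * 2 - s * (4 + s) * a) ^ 2 / (4 * (2 + s) ^ 3 * (4 + s)) := by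
    positivity
  linarith

lemma tilt_le_lbAcc_mul_lbProp {σ : ℝ} (hσ : 0 < σ) (x y : Ed d) :
    tiltMass d (σ ^ 2) * (gaussDens (tiltVar (σ ^ 2)) ((2 / (2 + σ ^ 2)) • x) y -
      1 / ((2 + σ ^ 2) * (4 + σ ^ 2)) *
        (gaussDens (tiltVar (σ ^ 2)) ((2 / (2 + σ ^ 2)) • x) y *
          ⟪‖x‖⁻¹ • x, y - (2 / (2 + σ ^ 2)) • x⟫ ^ 2)) ≤
      lbAcc d σ x y * lbProp σ x y := by
  have h := norm_sq_sub_le (s := σ ^ 2) (by positivity) x y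
  set t := 1 / ((2 + σ ^ 2) * (4 + σ ^ 2)) * ⟪‖x‖⁻¹ • x, y - (2 / (2 + σ ^ 2)) • x⟫ ^ 2 with ht
  have ht0 : 0 ≤ t := by positivity
  set r := σ ^ 2 / (4 * (2 + σ ^ 2)) * ‖y - (2 / (2 + σ ^ 2)) • x‖ ^ 2 with hr
  have hr0 : 0 ≤ r := by positivity
  have hacc : exp (-r) * (1 - t) ≤ lbAcc d σ x y := by
    have h1 : exp (-r) * (1 - t) ≤ exp (-(r + t)) := by
      rw [neg_add, Real.exp_add]
      gcongr
      linarith [Real.add_one_le_exp (-t)]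
    refine h1.trans ?_
    rw [lbAcc_eq hσ]
    refine le_min (exp_le_one_iff.2 (by linarith)) (Real.exp_le_exp.2 ?_)
    linarith
  have hpos := lbProp_pos hσ x y
  have heq := lbProp_mul_exp hσ x y
  rw [← hr] at heq
  calc _ = tiltMass d (σ ^ 2) * gaussDens (tiltVar (σ ^ 2)) ((2 / (2 + σ ^ 2)) • x) y *
        (1 - t) := by rw [ht]; ring
    _ = exp (-r) * (1 - t) * lbProp σ x y := by rw [← heq]; ring
    _ ≤ _ := by gcongr

/-- The probability of `A` under the tilted proposal from `x`. -/
def tiltProb (s : ℝ) (A : Set (Ed d)) (x : Ed d) : ℝ :=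
  ∫ y in A, gaussDens (tiltVar s) ((2 / (2 + s)) • x) y

lemma tiltProb_compl {s : ℝ} (hs : 0 < s) {A : Set (Ed d)} (hA : MeasurableSet A) (x : Ed d) :
    tiltProb s Aᶜ x = 1 - tiltProb s A x := by
  have h := integral_add_compl hA (integrable_gaussDens (tiltVar_pos hs) ((2 / (2 + s)) • x))
  rw [integral_gaussDens (tiltVar_pos hs)] at h
  rw [tiltProb, tiltProb]
  linarith

lemma tiltVar_mul_le {s : ℝ} (hs : 0 < s) :
    1 / ((2 + s) * (4 + s)) * tiltVar s ≤ 1 / 20 := by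
  rw [tiltVar, div_mul_div_comm, div_le_div_iff₀ (by positivity) (by positivity)]
  have h : 0 ≤ (2 + s) * s ^ 2 * (4 + s) := by positivity
  have h2 : 40 * s ≤ (2 + s) ^ 2 * (4 + s) := by nlinarith [sq_nonneg (s - 5 / 4), hs]
  nlinarith [mul_le_mul_of_nonneg_left h2 (by positivity : 0 ≤ 2 + s)]

lemma ofReal_integral_le_lintegral_ofReal {α : Type*} [MeasurableSpace α] {μ : Measure α}
    {f : α → ℝ} (hf : Integrable f μ) :
    ENNReal.ofReal (∫ x, f x ∂μ) ≤ ∫⁻ x, ENNReal.ofReal (f x) ∂μ := by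
  rw [integral_eq_lintegral_pos_part_sub_lintegral_neg_part hf]
  refine (ofReal_le_ofReal (sub_le_self _ toReal_nonneg)).trans ?_
  exact ofReal_toReal_le

lemma tiltProb_le_lintegral {σ : ℝ} (hσ : 0 < σ) {B : Set (Ed d)} (x : Ed d) :
    ENNReal.ofReal (tiltMass d (σ ^ 2) * (tiltProb (σ ^ 2) B x - 1 / 20)) ≤
      ∫⁻ y in B, ENNReal.ofReal (lbAcc d σ x y * lbProp σ x y) := by
  have hs : 0 < σ ^ 2 := by positivity
  have hw := tiltVar_pos hs
  set c := (2 / (2 + σ ^ 2)) • x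
  set e := ‖x‖⁻¹ • x with he
  have he1 : ‖e‖ ^ 2 ≤ 1 := by
    rw [he, norm_smul, norm_inv, norm_norm]
    rcases eq_or_ne ‖x‖ 0 with h | h
    · simp [h]
    · rw [inv_mul_cancel₀ h]; norm_num
  have hi1 := integrable_gaussDens hw c
  have hi2 := (integrable_gaussDens_mul_inner_sq hw c e).const_mul
    (1 / ((2 + σ ^ 2) * (4 + σ ^ 2)))
  have hi3 : Integrable fun y => gaussDens (tiltVar (σ ^ 2)) c y -
      1 / ((2 + σ ^ 2) * (4 + σ ^ 2)) * (gaussDens (tiltVar (σ ^ 2)) c y * ⟪e, y - c⟫ ^ 2) :=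
    hi1.sub hi2
  have hle : ∫ y in B, 1 / ((2 + σ ^ 2) * (4 + σ ^ 2)) *
      (gaussDens (tiltVar (σ ^ 2)) c y * ⟪e, y - c⟫ ^ 2) ≤ 1 / 20 := by
    refine (setIntegral_le_integral hi2 (ae_of_all _ fun y => ?_)).trans ?_
    · have := gaussDens_pos hw c y
      simp only [Pi.zero_apply]
      positivity
    · rw [integral_const_mul, integral_gaussDens_mul_inner_sq hw]
      refine le_trans ?_ (tiltVar_mul_le hs)
      gcongr
      exact mul_le_of_le_one_right hw.le he1
  calc ENNReal.ofReal (tiltMass d (σ ^ 2) * (tiltProb (σ ^ 2) B x - 1 / 20))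
      ≤ ENNReal.ofReal (∫ y in B, tiltMass d (σ ^ 2) * (gaussDens (tiltVar (σ ^ 2)) c y -
          1 / ((2 + σ ^ 2) * (4 + σ ^ 2)) *
            (gaussDens (tiltVar (σ ^ 2)) c y * ⟪e, y - c⟫ ^ 2))) := by
        refine ofReal_le_ofReal ?_
        rw [integral_const_mul, integral_sub hi1.integrableOn hi2.integrableOn]
        have := tiltMass_pos (d := d) (σ ^ 2)
        gcongr
        exact le_rfl
    _ ≤ ∫⁻ y in B, ENNReal.ofReal (tiltMass d (σ ^ 2) * (gaussDens (tiltVar (σ ^ 2)) c y -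
          1 / ((2 + σ ^ 2) * (4 + σ ^ 2)) *
            (gaussDens (tiltVar (σ ^ 2)) c y * ⟪e, y - c⟫ ^ 2))) :=
        ofReal_integral_le_lintegral_ofReal (hi3.const_mul _).integrableOn
    _ ≤ _ := lintegral_mono fun y => ofReal_le_ofReal (tilt_le_lbAcc_mul_lbProp hσ x y)

lemma gaussDens_mul_gaussDens {w : ℝ} (hw : 0 < w) (c c' y : Ed d) :
    gaussDens w c y * gaussDens w c' y =
      (gaussDens w ((1 / 2 : ℝ) • (c + c')) y * exp (-‖c - c'‖ ^ 2 / (8 * w))) ^ 2 := by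
  have h1 : ‖y - c‖ ^ 2 + ‖y - c'‖ ^ 2 =
      2 * ‖y - (1 / 2 : ℝ) • (c + c')‖ ^ 2 + ‖c - c'‖ ^ 2 / 2 := by
    have e1 : y - c = (y - (1 / 2 : ℝ) • (c + c')) - (1 / 2 : ℝ) • (c - c') := by module
    have e2 : y - c' = (y - (1 / 2 : ℝ) • (c + c')) + (1 / 2 : ℝ) • (c - c') := by module
    rw [e1, e2, norm_sub_sq_real, norm_add_sq_real, norm_smul, mul_pow]
    norm_num
    ring
  rw [gaussDens, gaussDens, gaussDens]
  generalize (2 * π * w) ^ (-(d : ℝ) / 2) = a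
  have h2 : exp (-‖y - c‖ ^ 2 / (2 * w)) * exp (-‖y - c'‖ ^ 2 / (2 * w)) =
      (exp (-‖y - (1 / 2 : ℝ) • (c + c')‖ ^ 2 / (2 * w)) * exp (-‖c - c'‖ ^ 2 / (8 * w))) ^ 2 := by
    rw [← Real.exp_add, ← Real.exp_add, ← Real.exp_nat_mul]
    congr 1
    push_cast
    field_simp
    linear_combination (-8 : ℝ) * h1
  linear_combination a ^ 2 * h2

lemma integral_abs_gaussDens_sub_le {w : ℝ} (hw : 0 < w) (c c' : Ed d) :
    ∫ y, |gaussDens w c y - gaussDens w c' y| ≤ ‖c - c'‖ / √w := by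
  rcases eq_or_ne c c' with rfl | hne
  · simp
  have hcc : 0 < ‖c - c'‖ := norm_pos_iff.2 (sub_ne_zero.2 hne)
  have hs : 0 < √w := sqrt_pos.2 hw
  set δ := ‖c - c'‖ / √w with hδ
  have hδ0 : 0 < δ := by positivity
  set m := (1 / 2 : ℝ) • (c + c')
  set E := exp (-‖c - c'‖ ^ 2 / (8 * w)) with hE
  have hE1 : 1 - δ ^ 2 / 8 ≤ E := by
    have h := Real.add_one_le_exp (-‖c - c'‖ ^ 2 / (8 * w))
    have h2 : -‖c - c'‖ ^ 2 / (8 * w) = -(δ ^ 2 / 8) := by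
      rw [hδ, div_pow, sq_sqrt hw.le]; field_simp
    rw [hE, h2]
    rw [h2] at h
    linarith
  have hE2 : E ≤ 1 := exp_le_one_iff.2 (by
    rw [neg_div]; exact neg_nonpos.2 (by positivity))
  have hp := fun y => gaussDens_pos hw c y
  have hq := fun y => gaussDens_pos hw c' y
  have hr := fun y => gaussDens_pos hw m y
  have ip := integrable_gaussDens hw c
  have iq := integrable_gaussDens hw c'
  have ir := (integrable_gaussDens hw m).mul_const E
  have hpt : ∀ y, |gaussDens w c y - gaussDens w c' y| ≤
      (2 / δ + δ / 8) * (gaussDens w c y + gaussDens w c' y) -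
        2 * (2 / δ - δ / 8) * (gaussDens w m y * E) := by
    intro y
    have h := gaussDens_mul_gaussDens hw c c' y
    set p := √(gaussDens w c y)
    set q := √(gaussDens w c' y)
    have hp2 : gaussDens w c y = p ^ 2 := (sq_sqrt (hp y).le).symm
    have hq2 : gaussDens w c' y = q ^ 2 := (sq_sqrt (hq y).le).symm
    have hp0 : 0 ≤ p := sqrt_nonneg _
    have hq0 : 0 ≤ q := sqrt_nonneg _
    have hpq : gaussDens w m y * E = p * q := by
      rw [hp2, hq2, ← mul_pow] at h
      exact ((sq_eq_sq₀ (mul_nonneg hp0 hq0) (mul_nonneg (hr y).le (exp_pos _).le)).1 h).symm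
    rw [hpq, hp2, hq2]
    have hsq : p ^ 2 - q ^ 2 = (p - q) * (p + q) := by ring
    rw [hsq, abs_le]
    have e : (2 / δ + δ / 8) * (p ^ 2 + q ^ 2) - 2 * (2 / δ - δ / 8) * (p * q) =
      2 / δ * (p - q) ^ 2 + δ / 8 * (p + q) ^ 2 := by ring
    rw [e]
    have k1 : 2 / δ * (p - q) ^ 2 + δ / 8 * (p + q) ^ 2 - (p - q) * (p + q) =
      2 / δ * ((p - q) - δ / 4 * (p + q)) ^ 2 := by field_simp; ring
    have k2 : 2 / δ * (p - q) ^ 2 + δ / 8 * (p + q) ^ 2 + (p - q) * (p + q) =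
      2 / δ * ((p - q) + δ / 4 * (p + q)) ^ 2 := by field_simp; ring
    have n1 : 0 ≤ 2 / δ * ((p - q) - δ / 4 * (p + q)) ^ 2 := by positivity
    have n2 : 0 ≤ 2 / δ * ((p - q) + δ / 4 * (p + q)) ^ 2 := by positivity
    constructor <;> linarith
  have i1 : Integrable fun y => (2 / δ + δ / 8) * (gaussDens w c y + gaussDens w c' y) :=
    (ip.add iq).const_mul _
  have i2 := ir.const_mul (2 * (2 / δ - δ / 8))
  calc ∫ y, |gaussDens w c y - gaussDens w c' y|
      ≤ ∫ y, ((2 / δ + δ / 8) * (gaussDens w c y + gaussDens w c' y) -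
        2 * (2 / δ - δ / 8) * (gaussDens w m y * E)) :=
        integral_mono (ip.sub iq).abs (i1.sub i2) hpt
    _ = (2 / δ + δ / 8) * 2 - 2 * (2 / δ - δ / 8) * E := by
        rw [integral_sub i1 i2, integral_const_mul, integral_const_mul, integral_mul_const,
          integral_add ip iq, integral_gaussDens hw, integral_gaussDens hw, integral_gaussDens hw]
        ring
    _ = 4 / δ * (1 - E) + δ / 4 * (1 + E) := by ring
    _ ≤ 4 / δ * (δ ^ 2 / 8) + δ / 4 * 2 := by gcongr <;> linarith
    _ = δ := by field_simp; ring

lemma abs_setIntegral_gaussDens_sub_le {w : ℝ} (hw : 0 < w) {A : Set (Ed d)}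
    (hA : MeasurableSet A) (c c' : Ed d) :
    |(∫ y in A, gaussDens w c y) - ∫ y in A, gaussDens w c' y| ≤ ‖c - c'‖ / √w / 2 := by
  have ip := integrable_gaussDens hw c
  have iq := integrable_gaussDens hw c'
  have i : Integrable fun y => gaussDens w c y - gaussDens w c' y := ip.sub iq
  have h1 := integral_add_compl hA i
  have h2 := integral_add_compl hA i.abs
  rw [integral_sub ip iq, integral_gaussDens hw, integral_gaussDens hw, sub_self] at h1
  have a1 := abs_integral_le_integral_abs (μ := volume.restrict A)
    (f := fun y => gaussDens w c y - gaussDens w c' y)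
  have a2 := abs_integral_le_integral_abs (μ := volume.restrict Aᶜ)
    (f := fun y => gaussDens w c y - gaussDens w c' y)
  have h3 := integral_abs_gaussDens_sub_le hw c c'
  rw [← integral_sub ip.integrableOn iq.integrableOn]
  rw [eq_neg_of_add_eq_zero_right h1, abs_neg] at a2
  linarith

lemma lipschitzWith_tiltProb {s : ℝ} (hs : 0 < s) {A : Set (Ed d)} (hA : MeasurableSet A) :
    LipschitzWith (2 / (2 + s) / √(tiltVar s) / 2).toNNReal (tiltProb s A) := by
  refine LipschitzWith.of_dist_le_mul fun x x' => ?_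
  rw [Real.dist_eq, dist_eq_norm, Real.coe_toNNReal _ (by positivity)]
  refine (abs_setIntegral_gaussDens_sub_le (tiltVar_pos hs) hA _ _).trans_eq ?_
  rw [← smul_sub, norm_smul, norm_of_nonneg (by positivity)]
  ring

/-- The truncation of `G` to `[1/4, 3/4]`. -/
def clip (G : Ed d → ℝ) (x : Ed d) : ℝ := max (1 / 4) (min (3 / 4) (G x))

lemma lipschitzWith_clip {G : Ed d → ℝ} {L : NNReal} (hG : LipschitzWith L G) :
    LipschitzWith L (clip G) := (hG.const_min _).const_max _

lemma fderiv_clip_eq_zero {G : Ed d → ℝ} (hG : Continuous G) {x : Ed d}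
    (hx : x ∉ {x | 1 / 4 ≤ G x ∧ G x ≤ 3 / 4}) : fderiv ℝ (clip G) x = 0 := by
  rw [Set.mem_ofPred_eq, not_and_or, not_le, not_le] at hx
  rcases hx with hx | hx
  · have : clip G =ᶠ[𝓝 x] fun _ => 1 / 4 := by
      filter_upwards [hG.continuousAt.eventually_lt_const hx] with y hy
      exact max_eq_left ((min_le_right _ _).trans hy.le)
    rw [this.fderiv_eq, fderiv_fun_const]; rfl
  · have : clip G =ᶠ[𝓝 x] fun _ => 3 / 4 := by
      filter_upwards [hG.continuousAt.eventually_const_lt hx] with y hy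
      rw [clip, min_eq_left hy.le]; norm_num
    rw [this.fderiv_eq, fderiv_fun_const]; rfl

lemma measure_mul_measure_compl_le {G : Ed d → ℝ} {L : NNReal} (hG : LipschitzWith L G)
    {A : Set (Ed d)} (hA : MeasurableSet A) :
    (piMeasure d).real A * (piMeasure d).real Aᶜ ≤ (1 + π / 2 * L) *
      ((piMeasure d).real (A ∩ {x | G x ≤ 3 / 4}) +
        (piMeasure d).real (Aᶜ ∩ {x | 1 / 4 ≤ G x})) := by
  have hGm : Measurable G := hG.continuous.measurable
  set μ := piMeasure d
  have hB1 : MeasurableSet (A ∩ {x | G x ≤ 3 / 4}) := hA.inter (measurableSet_le hGm (by fun_prop))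
  have hB2 : MeasurableSet (Aᶜ ∩ {x | 1 / 4 ≤ G x}) :=
    hA.compl.inter (measurableSet_le (by fun_prop) hGm)
  set B := (A ∩ {x | G x ≤ 3 / 4}) ∪ (Aᶜ ∩ {x | 1 / 4 ≤ G x}) with hBdef
  have hB : MeasurableSet B := hB1.union hB2
  have hS : MeasurableSet {x | 1 / 4 ≤ G x ∧ G x ≤ 3 / 4} :=
    (measurableSet_le (by fun_prop) hGm).inter (measurableSet_le hGm (by fun_prop))
  have hSB : μ.real {x | 1 / 4 ≤ G x ∧ G x ≤ 3 / 4} ≤ μ.real B := by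
    refine measureReal_mono fun x hx => ?_
    by_cases hxA : x ∈ A
    · exact Or.inl ⟨hxA, hx.2⟩
    · exact Or.inr ⟨hxA, hx.1⟩
  have hBle : μ.real B ≤ μ.real (A ∩ {x | G x ≤ 3 / 4}) + μ.real (Aᶜ ∩ {x | 1 / 4 ≤ G x}) :=
    measureReal_union_le _ _
  have hlip := integral_abs_sub_le_of_lipschitz (lipschitzWith_clip hG) hS
    fun x hx => fderiv_clip_eq_zero hG.continuous hx
  have hind : ∀ {T : Set (Ed d)}, MeasurableSet T →
      Integrable (T.indicator (1 : Ed d → ℝ)) μ := fun hT =>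
    (integrable_const (1 : ℝ)).indicator hT
  have hpt : ∀ p : Ed d × Ed d,
      A.indicator (1 : Ed d → ℝ) p.1 * Aᶜ.indicator (1 : Ed d → ℝ) p.2 +
        Aᶜ.indicator (1 : Ed d → ℝ) p.1 * A.indicator (1 : Ed d → ℝ) p.2 ≤
      2 * |clip G p.1 - clip G p.2| +
        (B.indicator (1 : Ed d → ℝ) p.1 + B.indicator (1 : Ed d → ℝ) p.2) := by
    have key : ∀ x y : Ed d, x ∈ A → y ∉ A → 1 ≤ 2 * |clip G x - clip G y| +
        (B.indicator (1 : Ed d → ℝ) x + B.indicator (1 : Ed d → ℝ) y) := by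
      intro x y hx hy
      have n1 : 0 ≤ |clip G x - clip G y| := abs_nonneg _
      have n2 : 0 ≤ B.indicator (1 : Ed d → ℝ) x := Set.indicator_nonneg (by simp) _
      have n3 : 0 ≤ B.indicator (1 : Ed d → ℝ) y := Set.indicator_nonneg (by simp) _
      by_cases hxB : x ∈ B
      · rw [Set.indicator_of_mem hxB] at *; simp only [Pi.one_apply]; linarith
      by_cases hyB : y ∈ B
      · rw [Set.indicator_of_mem hyB] at *; simp only [Pi.one_apply]; linarith
      have hGx : 3 / 4 < G x := by
        by_contra! h; exact hxB (Or.inl ⟨hx, h⟩)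
      have hGy : G y < 1 / 4 := by
        by_contra! h; exact hyB (Or.inr ⟨hy, h⟩)
      have e1 : clip G x = 3 / 4 := by rw [clip, min_eq_left hGx.le]; norm_num
      have e2 : clip G y = 1 / 4 := max_eq_left ((min_le_right _ _).trans hGy.le)
      rw [e1, e2]
      norm_num
      linarith
    rintro ⟨x, y⟩
    by_cases hx : x ∈ A <;> by_cases hy : y ∈ A
    · simp only [Set.indicator_of_mem hx, Set.indicator_of_mem hy,
        Set.indicator_of_notMem (Set.notMem_compl_iff.2 hx),
        Set.indicator_of_notMem (Set.notMem_compl_iff.2 hy), mul_zero, zero_mul, add_zero]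
      exact add_nonneg (by positivity) (add_nonneg (Set.indicator_nonneg (by simp) _)
        (Set.indicator_nonneg (by simp) _))
    · have := key x y hx hy
      simpa [hx, hy] using this
    · have := key y x hy hx
      rw [abs_sub_comm, add_comm (B.indicator _ y)] at this
      simpa [hx, hy] using this
    · simp only [Set.indicator_of_notMem hx, Set.indicator_of_notMem hy,
        mul_zero, zero_mul, add_zero]
      exact add_nonneg (by positivity) (add_nonneg (Set.indicator_nonneg (by simp) _)
        (Set.indicator_nonneg (by simp) _))
  have i1 := (hind hA).mul_prod (hind hA.compl)
  have i2 := (hind hA.compl).mul_prod (hind hA)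
  have i3 := (hind hB).comp_fst μ
  have i4 := (hind hB).comp_snd μ
  have hclip : Continuous (clip G) := (lipschitzWith_clip hG).continuous
  have ib : Integrable (fun p : Ed d × Ed d => |clip G p.1 - clip G p.2|) (μ.prod μ) := by
    refine Integrable.mono' (integrable_const (1 : ℝ))
      (Continuous.aestronglyMeasurable (by fun_prop)) (ae_of_all _ fun p => ?_)
    have b : ∀ x, 1 / 4 ≤ clip G x ∧ clip G x ≤ 3 / 4 := fun x =>
      ⟨le_max_left _ _, max_le (by norm_num) (min_le_left _ _)⟩
    rw [norm_of_nonneg (abs_nonneg _), abs_le]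
    constructor <;> linarith [b p.1, b p.2]
  have i34 : Integrable (fun p : Ed d × Ed d => B.indicator (1 : Ed d → ℝ) p.1 +
      B.indicator (1 : Ed d → ℝ) p.2) (μ.prod μ) := i3.add i4
  have hint := integral_mono (i1.add i2) ((ib.const_mul 2).add i34) hpt
  simp only [Pi.add_apply] at hint
  rw [integral_add i1 i2, integral_add (ib.const_mul 2) i34, integral_add i3 i4,
    integral_const_mul, integral_prod_mul, integral_prod_mul, integral_fun_fst, integral_fun_snd,
    integral_indicator_one hA, integral_indicator_one hA.compl, integral_indicator_one hB] at hint
  simp only [probReal_univ, one_smul] at hint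
  have hL : 0 ≤ π / 2 * (L : ℝ) := by positivity
  have hm := mul_le_mul_of_nonneg_left (hSB.trans hBle) hL
  rw [← mul_assoc] at hlip
  linarith

/-- The stationary flow from `A` to `B`. -/
def setFlow (d : ℕ) (σ : ℝ) (A B : Set (Ed d)) : ℝ≥0∞ :=
  ∫⁻ x in A, ∫⁻ y in B, ENNReal.ofReal (lbFlow d σ x y)

lemma setFlow_comm {σ : ℝ} (hσ : 0 < σ) (A B : Set (Ed d)) :
    setFlow d σ A B = setFlow d σ B A := by
  rw [setFlow, setFlow, lintegral_lintegral_swap (measurable_lbFlow σ).ennreal_ofReal.aemeasurable]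
  simp only [lbFlow_comm hσ]

lemma piMeasure_apply {A : Set (Ed d)} (hA : MeasurableSet A) :
    piMeasure d A = ∫⁻ x in A, ENNReal.ofReal (stdGauss d x) :=
  withDensity_apply _ hA

lemma mul_measure_le_setFlow {σ : ℝ} (hσ : 0 < σ) {A C : Set (Ed d)} (hA : MeasurableSet A)
    (hC : MeasurableSet C) (hCA : C ⊆ A) (h : ∀ x ∈ C, tiltProb (σ ^ 2) A x ≤ 3 / 4) :
    ENNReal.ofReal (tiltMass d (σ ^ 2) / 5) * piMeasure d C ≤ setFlow d σ A Aᶜ := by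
  have hD := tiltMass_pos (d := d) (σ ^ 2)
  rw [piMeasure_apply hC, ← lintegral_const_mul' _ _ ofReal_ne_top, setFlow]
  refine le_trans ?_ (lintegral_mono_set hCA)
  refine setLIntegral_mono' hC fun x hx => ?_
  have h1 := tiltProb_le_lintegral hσ (B := Aᶜ) x
  rw [tiltProb_compl (by positivity) hA] at h1
  calc _ ≤ ENNReal.ofReal (tiltMass d (σ ^ 2) * (1 - tiltProb (σ ^ 2) A x - 1 / 20)) *
        ENNReal.ofReal (stdGauss d x) := by
        gcongr
        rw [div_eq_mul_inv]
        gcongr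
        linarith [h x hx]
    _ ≤ (∫⁻ y in Aᶜ, ENNReal.ofReal (lbAcc d σ x y * lbProp σ x y)) *
        ENNReal.ofReal (stdGauss d x) := by gcongr
    _ = _ := by
        rw [← lintegral_mul_const' _ _ ofReal_ne_top]
        refine lintegral_congr fun y => ?_
        rw [← ofReal_mul (mul_nonneg (lbAcc_nonneg hσ _ _) (lbProp_pos hσ _ _).le)]
        rfl

/-- The isoperimetric lower bound for the conductance, as a function of `s = σ²`. -/
def conductanceBound (d : ℕ) (s : ℝ) : ℝ :=
  tiltMass d s / (20 * (1 + π / 4 * (2 / (2 + s) / √(tiltVar s))))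

lemma conductanceBound_mul_le_setFlow {σ : ℝ} (hσ : 0 < σ) {A : Set (Ed d)}
    (hA : MeasurableSet A) (hA2 : piMeasure d A ≤ 1 / 2) :
    ENNReal.ofReal (conductanceBound d (σ ^ 2)) * piMeasure d A ≤ setFlow d σ A Aᶜ := by
  have hs : 0 < σ ^ 2 := by positivity
  have hD := tiltMass_pos (d := d) (σ ^ 2)
  rcases eq_or_ne (setFlow d σ A Aᶜ) ⊤ with hF | hF
  · simp [hF]
  set μ := piMeasure d
  set G := tiltProb (σ ^ 2) A
  have hG : LipschitzWith _ G := lipschitzWith_tiltProb hs hA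
  have hGm : Measurable G := hG.continuous.measurable
  have h1 := mul_measure_le_setFlow hσ hA
    (hA.inter (measurableSet_le hGm measurable_const : MeasurableSet {x | G x ≤ 3 / 4}))
    Set.inter_subset_left fun x hx => hx.2
  have h2 := mul_measure_le_setFlow hσ hA.compl
    (hA.compl.inter (measurableSet_le measurable_const hGm : MeasurableSet {x | 1 / 4 ≤ G x}))
    Set.inter_subset_left fun x hx => by
      rw [tiltProb_compl hs hA]; linarith [show 1 / 4 ≤ G x from hx.2]
  rw [compl_compl, setFlow_comm hσ] at h2
  have h3 := measure_mul_measure_compl_le hG hA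
  rw [Real.coe_toNNReal _ (by positivity)] at h3
  have k1 := toReal_mono hF h1
  have k2 := toReal_mono hF h2
  rw [toReal_mul, toReal_ofReal (by positivity), ← measureReal_def] at k1 k2
  have hA3 : μ.real A ≤ 1 / 2 := by
    have := toReal_mono (by simp) hA2
    simpa [measureReal_def] using this
  have hA4 : 1 / 2 ≤ μ.real Aᶜ := by
    rw [probReal_compl_eq_one_sub hA]; linarith
  rw [← ofReal_toReal hF, ← ofReal_toReal (measure_ne_top μ A), ← measureReal_def,
    ← ofReal_mul (by unfold conductanceBound; positivity)]
  refine ofReal_le_ofReal ?_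
  set F := (setFlow d σ A Aᶜ).toReal
  set r := 2 / (2 + σ ^ 2) / √(tiltVar (σ ^ 2)) with hr
  have hr0 : 0 ≤ r := by positivity
  have hA0 : 0 ≤ μ.real A := measureReal_nonneg
  rw [conductanceBound, ← hr, div_mul_eq_mul_div, div_le_iff₀ (by positivity)]
  set P1 := μ.real (A ∩ {x | G x ≤ 3 / 4})
  set P2 := μ.real (Aᶜ ∩ {x | 1 / 4 ≤ G x})
  set D := tiltMass d (σ ^ 2)
  have h4 : μ.real A * (1 / 2) ≤ (1 + π / 4 * r) * (P1 + P2) := by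
    calc μ.real A * (1 / 2) ≤ μ.real A * μ.real Aᶜ := by gcongr
      _ ≤ _ := h3
      _ = _ := by ring
  calc D * μ.real A = 2 * D * (μ.real A * (1 / 2)) := by ring
    _ ≤ 2 * D * ((1 + π / 4 * r) * (P1 + P2)) := by gcongr
    _ = 10 * (1 + π / 4 * r) * (D / 5 * P1 + D / 5 * P2) := by ring
    _ ≤ 10 * (1 + π / 4 * r) * (F + F) := by gcongr
    _ = _ := by ring

section Cheeger

variable {X : Type*} [MeasurableSpace X] {μ : Measure X} {m : Measure (X × X)}

lemma lintegral_layer_cake_sub [SFinite m] {a : X → ℝ} (ha : Measurable a) (ha0 : ∀ x, 0 ≤ a x) :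
    ∫⁻ p, ENNReal.ofReal (a p.1 - a p.2) ∂m =
      ∫⁻ t in Set.Ioi (0 : ℝ), m ({x | t < a x} ×ˢ {x | t < a x}ᶜ) := by
  have hmeas : MeasurableSet {q : (X × X) × ℝ | a q.1.2 ≤ q.2 ∧ q.2 < a q.1.1} :=
    (measurableSet_le (f := fun q : (X × X) × ℝ => a q.1.2) (by fun_prop)
      measurable_snd).inter
      (measurableSet_lt (g := fun q : (X × X) × ℝ => a q.1.1) measurable_snd (by fun_prop))
  set I : X × X → ℝ → ℝ≥0∞ := fun p t =>
    {q : (X × X) × ℝ | a q.1.2 ≤ q.2 ∧ q.2 < a q.1.1}.indicator 1 (p, t) with hI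
  have hIm : Measurable (Function.uncurry I) := measurable_one.indicator hmeas
  calc ∫⁻ p, ENNReal.ofReal (a p.1 - a p.2) ∂m
      = ∫⁻ p, (∫⁻ t in Set.Ioi (0 : ℝ), I p t) ∂m := by
        refine lintegral_congr fun p => ?_
        have h1 : ∀ t, I p t = (Set.Ico (a p.2) (a p.1)).indicator 1 t := fun t => rfl
        simp only [h1]
        rw [lintegral_indicator_one measurableSet_Ico, Measure.restrict_apply measurableSet_Ico]
        refine le_antisymm ?_ ?_
        · rw [← Real.volume_Ioo]
          exact measure_mono fun t ht => ⟨⟨ht.1.le, ht.2⟩, (ha0 _).trans_lt ht.1⟩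
        · rw [← Real.volume_Ico]
          exact measure_mono Set.inter_subset_left
    _ = ∫⁻ t in Set.Ioi (0 : ℝ), (∫⁻ p, I p t ∂m) := lintegral_lintegral_swap hIm.aemeasurable
    _ = _ := by
        refine lintegral_congr fun t => ?_
        have hs : MeasurableSet {x | t < a x} := measurableSet_lt measurable_const ha
        rw [← lintegral_indicator_one (hs.prod hs.compl)]
        refine lintegral_congr fun p => ?_
        simp only [hI, Set.indicator_apply, Set.mem_ofPred_eq, Set.mem_prod, Set.mem_compl_iff,
          not_lt]
        simp only [and_comm, Pi.one_apply]

lemma lintegral_layer_cake {a : X → ℝ} (ha : Measurable a) (ha0 : ∀ x, 0 ≤ a x) :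
    ∫⁻ x, ENNReal.ofReal (a x) ∂μ = ∫⁻ t in Set.Ioi (0 : ℝ), μ {x | t < a x} :=
  lintegral_eq_lintegral_meas_lt μ (ae_of_all _ ha0) ha.aemeasurable

/-- Cheeger's inequality for a nonnegative function supported on at most half of the mass. -/
lemma cheeger_nonneg [SFinite m] (hswap : m.map Prod.swap = m) (hmarg : m.map Prod.fst ≤ μ)
    {κ : ℝ} (hκ : 0 < κ)
    (hcond : ∀ A, MeasurableSet A → μ A ≤ 1 / 2 → ENNReal.ofReal κ * μ A ≤ m (A ×ˢ Aᶜ))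
    {u : X → ℝ} (hu : Measurable u) (hu0 : ∀ x, 0 ≤ u x) (hsupp : μ {x | 0 < u x} ≤ 1 / 2)
    (hfin : ∫⁻ x, ENNReal.ofReal (u x ^ 2) ∂μ ≠ ⊤) :
    ENNReal.ofReal (κ ^ 2) * ∫⁻ x, ENNReal.ofReal (u x ^ 2) ∂μ ≤
      ∫⁻ p, ENNReal.ofReal ((u p.1 - u p.2) ^ 2) ∂m := by
  set U := ∫⁻ x, ENNReal.ofReal (u x ^ 2) ∂μ
  set E := ∫⁻ p, ENNReal.ofReal ((u p.1 - u p.2) ^ 2) ∂m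
  have hsq : Measurable fun x => u x ^ 2 := hu.pow_const 2
  have hmsnd : m.map Prod.snd ≤ μ := by
    rw [← hswap, Measure.map_map measurable_snd measurable_swap]
    exact hmarg
  have hpos : ENNReal.ofReal κ * U ≤ ∫⁻ p, ENNReal.ofReal (u p.1 ^ 2 - u p.2 ^ 2) ∂m := by
    rw [lintegral_layer_cake_sub hsq fun x => sq_nonneg _,
      show U = _ from lintegral_layer_cake hsq fun x => sq_nonneg _,
      ← lintegral_const_mul' _ _ ofReal_ne_top]
    refine setLIntegral_mono' measurableSet_Ioi fun t ht => ?_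
    refine hcond _ (measurableSet_lt measurable_const hsq) (le_trans (measure_mono ?_) hsupp)
    intro x hx
    have hx : t < u x ^ 2 := hx
    exact (hu0 x).lt_of_ne fun h => by
      rw [← h] at hx
      simp only [Set.mem_Ioi] at ht
      norm_num at hx
      linarith
  have hneg : ∫⁻ p, ENNReal.ofReal (u p.2 ^ 2 - u p.1 ^ 2) ∂m =
      ∫⁻ p, ENNReal.ofReal (u p.1 ^ 2 - u p.2 ^ 2) ∂m := by
    conv_rhs => rw [← hswap]
    rw [lintegral_map (by fun_prop) measurable_swap]
    rfl
  have hm1 : ∫⁻ p, ENNReal.ofReal (u p.1 ^ 2) ∂m ≤ U := by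
    rw [← lintegral_map (f := fun x => ENNReal.ofReal (u x ^ 2)) (by fun_prop) measurable_fst]
    exact lintegral_mono' hmarg le_rfl
  have hm2 : ∫⁻ p, ENNReal.ofReal (u p.2 ^ 2) ∂m ≤ U := by
    rw [← lintegral_map (f := fun x => ENNReal.ofReal (u x ^ 2)) (by fun_prop) measurable_snd]
    exact lintegral_mono' hmsnd le_rfl
  have hle : ENNReal.ofReal κ * U + ENNReal.ofReal κ * U ≤
      ENNReal.ofReal κ⁻¹ * E + ENNReal.ofReal (κ / 2) * (U + U) := by
    calc ENNReal.ofReal κ * U + ENNReal.ofReal κ * U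
        ≤ ∫⁻ p, ENNReal.ofReal (u p.1 ^ 2 - u p.2 ^ 2) ∂m +
          ∫⁻ p, ENNReal.ofReal (u p.2 ^ 2 - u p.1 ^ 2) ∂m := by
          rw [hneg]; exact add_le_add hpos hpos
      _ = ∫⁻ p, (ENNReal.ofReal (u p.1 ^ 2 - u p.2 ^ 2) +
          ENNReal.ofReal (u p.2 ^ 2 - u p.1 ^ 2)) ∂m := (lintegral_add_left (by fun_prop) _).symm
      _ ≤ ∫⁻ p, (ENNReal.ofReal κ⁻¹ * ENNReal.ofReal ((u p.1 - u p.2) ^ 2) +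
          ENNReal.ofReal (κ / 2) *
            (ENNReal.ofReal (u p.1 ^ 2) + ENNReal.ofReal (u p.2 ^ 2))) ∂m := by
          refine lintegral_mono fun p => ?_
          simp only
          generalize u p.1 = a
          generalize u p.2 = b
          rw [← ofReal_add (sq_nonneg a) (sq_nonneg b), ← ofReal_mul (by positivity),
            ← ofReal_mul (by positivity),
            ← ofReal_add (mul_nonneg (inv_nonneg.2 hκ.le) (sq_nonneg (a - b)))
              (mul_nonneg (half_pos hκ).le (add_nonneg (sq_nonneg a) (sq_nonneg b)))]
          have k1 : κ⁻¹ * (a - b) ^ 2 + κ / 2 * (a ^ 2 + b ^ 2) - (a ^ 2 - b ^ 2) =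
              κ⁻¹ * ((a - b) - κ / 2 * (a + b)) ^ 2 + κ / 4 * (a - b) ^ 2 := by
            field_simp; ring
          have k2 : κ⁻¹ * (a - b) ^ 2 + κ / 2 * (a ^ 2 + b ^ 2) + (a ^ 2 - b ^ 2) =
              κ⁻¹ * ((a - b) + κ / 2 * (a + b)) ^ 2 + κ / 4 * (a - b) ^ 2 := by
            field_simp; ring
          have n1 : 0 ≤ κ⁻¹ * ((a - b) - κ / 2 * (a + b)) ^ 2 + κ / 4 * (a - b) ^ 2 := by
            positivity
          have n2 : 0 ≤ κ⁻¹ * ((a - b) + κ / 2 * (a + b)) ^ 2 + κ / 4 * (a - b) ^ 2 := by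
            positivity
          rcases le_total (b ^ 2) (a ^ 2) with h | h
          · rw [ofReal_of_nonpos (sub_nonpos.2 h), add_zero]
            exact ofReal_le_ofReal (by linarith)
          · rw [ofReal_of_nonpos (sub_nonpos.2 h), zero_add]
            exact ofReal_le_ofReal (by linarith)
      _ = ENNReal.ofReal κ⁻¹ * E + ENNReal.ofReal (κ / 2) *
          (∫⁻ p, ENNReal.ofReal (u p.1 ^ 2) ∂m + ∫⁻ p, ENNReal.ofReal (u p.2 ^ 2) ∂m) := by
          rw [lintegral_add_left (by fun_prop), lintegral_const_mul' _ _ ofReal_ne_top,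
            lintegral_const_mul' _ _ ofReal_ne_top, lintegral_add_left (by fun_prop)]
      _ ≤ _ := by gcongr
  rcases eq_or_ne E ⊤ with hE | hE
  · simp [hE]
  have hreal := toReal_mono (by finiteness) hle
  rw [toReal_add (by finiteness) (by finiteness), toReal_add (by finiteness) (by finiteness),
    toReal_mul, toReal_mul, toReal_mul, toReal_add hfin hfin, toReal_ofReal hκ.le,
    toReal_ofReal (by positivity), toReal_ofReal (by positivity)] at hreal
  rw [← ofReal_toReal hfin, ← ofReal_toReal hE, ← ofReal_mul (by positivity)]
  refine ofReal_le_ofReal ?_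
  have h2 : κ * U.toReal ≤ κ⁻¹ * E.toReal := by linarith
  calc κ ^ 2 * U.toReal = κ * (κ * U.toReal) := by ring
    _ ≤ κ * (κ⁻¹ * E.toReal) := by gcongr
    _ = E.toReal := by field_simp

lemma exists_median [IsProbabilityMeasure μ] {f : X → ℝ} (hf : Measurable f) :
    ∃ c, μ {x | c < f x} ≤ 1 / 2 ∧ μ {x | f x < c} ≤ 1 / 2 := by
  set ν := μ.map f
  have : IsProbabilityMeasure ν := Measure.isProbabilityMeasure_map hf.aemeasurable
  set F := cdf ν
  set T := {t | 1 / 2 ≤ F t}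
  have hne : T.Nonempty :=
    ((tendsto_cdf_atTop ν).eventually_const_le (by norm_num : (1 / 2 : ℝ) < 1)).exists
  have hbdd : BddBelow T := by
    obtain ⟨b, hb⟩ := ((tendsto_cdf_atBot ν).eventually_lt_const
      (by norm_num : (0 : ℝ) < 1 / 2)).exists
    refine ⟨b, fun t ht => ?_⟩
    by_contra! h
    have : F t ≤ F b := F.mono h.le
    have : 1 / 2 ≤ F t := ht
    linarith
  refine ⟨sInf T, ?_, ?_⟩
  · have hc : 1 / 2 ≤ F (sInf T) := by
      refine ge_of_tendsto ((F.right_continuous (sInf T)).tendsto.mono_left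
        (nhdsWithin_mono _ Set.Ioi_subset_Ici_self)) ?_
      filter_upwards [self_mem_nhdsWithin] with t ht
      obtain ⟨b, hb, hbt⟩ := exists_lt_of_csInf_lt hne ht
      exact le_trans hb (F.mono hbt.le)
    have h1 : μ {x | sInf T < f x} = ν (Set.Iic (sInf T))ᶜ := by
      rw [Set.compl_Iic, Measure.map_apply hf measurableSet_Ioi]; rfl
    rw [h1, prob_compl_eq_one_sub measurableSet_Iic, ← ofReal_cdf]
    have h2 : (1 / 2 : ℝ≥0∞) = 1 - ENNReal.ofReal (1 / 2) := by
      rw [← ofReal_one, ← ofReal_sub _ (by norm_num)]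
      norm_num [ofReal_div_of_pos]
    rw [h2]
    exact tsub_le_tsub_left (ofReal_le_ofReal hc) _
  · have h1 : μ {x | f x < sInf T} = ν (⋃ n : ℕ, Set.Iic (sInf T - 1 / ((n : ℝ) + 1))) := by
      rw [Measure.map_apply hf (.iUnion fun _ => measurableSet_Iic)]
      congr 1
      ext x
      simp only [Set.mem_ofPred_eq, Set.mem_preimage, Set.mem_iUnion, Set.mem_Iic]
      constructor
      · intro h
        obtain ⟨n, hn⟩ := exists_nat_one_div_lt (sub_pos.2 h)
        exact ⟨n, by linarith⟩
      · rintro ⟨n, hn⟩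
        have : (0 : ℝ) < 1 / ((n : ℝ) + 1) := by positivity
        linarith
    have hmono : Monotone fun n : ℕ => Set.Iic (sInf T - 1 / ((n : ℝ) + 1)) := by
      intro n k hnk
      refine Set.Iic_subset_Iic.2 (sub_le_sub_left ?_ _)
      exact Nat.one_div_le_one_div hnk
    rw [h1, hmono.measure_iUnion]
    refine iSup_le fun n => ?_
    rw [← ofReal_cdf]
    have h3 : F (sInf T - 1 / ((n : ℝ) + 1)) ≤ 1 / 2 := by
      by_contra! h
      have := csInf_le hbdd h.le
      have : (0 : ℝ) < 1 / ((n : ℝ) + 1) := by positivity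
      linarith
    refine (ofReal_le_ofReal h3).trans_eq ?_
    norm_num [ofReal_div_of_pos]

/-- Cheeger's inequality for a reversible flow. -/
lemma cheeger [IsProbabilityMeasure μ] [SFinite m] (hswap : m.map Prod.swap = m)
    (hmarg : m.map Prod.fst ≤ μ) {κ : ℝ} (hκ : 0 < κ)
    (hcond : ∀ A, MeasurableSet A → μ A ≤ 1 / 2 → ENNReal.ofReal κ * μ A ≤ m (A ×ˢ Aᶜ))
    {f : X → ℝ} (hf : Measurable f) (hfin : ∫⁻ x, ENNReal.ofReal (f x ^ 2) ∂μ < ⊤)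
    (hmean : ∫ x, f x ∂μ = 0) :
    ENNReal.ofReal (κ ^ 2) * ∫⁻ x, ENNReal.ofReal (f x ^ 2) ∂μ ≤
      ∫⁻ p, ENNReal.ofReal ((f p.1 - f p.2) ^ 2) ∂m := by
  obtain ⟨c, hc1, hc2⟩ := exists_median (μ := μ) hf
  have hsq : Integrable (fun x => f x ^ 2) μ := by
    refine ⟨by fun_prop, ?_⟩
    rw [hasFiniteIntegral_iff_ofReal (ae_of_all _ fun x => sq_nonneg _)]
    exact hfin
  have hL2 : MemLp f 2 μ := (memLp_two_iff_integrable_sq (by fun_prop)).2 hsq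
  have hL1 : Integrable f μ := hL2.integrable (by norm_num)
  have hsqc : Integrable (fun x => (f x - c) ^ 2) μ := (hL2.sub (memLp_const c)).integrable_sq
  have hge : ∫⁻ x, ENNReal.ofReal (f x ^ 2) ∂μ ≤ ∫⁻ x, ENNReal.ofReal ((f x - c) ^ 2) ∂μ := by
    rw [← ofReal_integral_eq_lintegral_ofReal hsq (ae_of_all _ fun x => sq_nonneg _),
      ← ofReal_integral_eq_lintegral_ofReal hsqc (ae_of_all _ fun x => sq_nonneg _)]
    refine ofReal_le_ofReal ?_
    have i1 : Integrable (fun x => 2 * c * f x) μ := hL1.const_mul _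
    have e : ∀ x, (f x - c) ^ 2 = f x ^ 2 - 2 * c * f x + c ^ 2 := fun x => by ring
    simp only [e]
    have i2 : Integrable (fun x => f x ^ 2 - 2 * c * f x) μ := hsq.sub i1
    rw [integral_add i2 (integrable_const _), integral_sub hsq i1, integral_const_mul,
      hmean]
    simp [sq_nonneg]
  have hUfin : ∫⁻ x, ENNReal.ofReal ((f x - c) ^ 2) ∂μ ≠ ⊤ := by
    rw [← ofReal_integral_eq_lintegral_ofReal hsqc (ae_of_all _ fun x => sq_nonneg _)]
    exact ofReal_ne_top
  have hb1 : ∀ x, max (f x - c) 0 ^ 2 ≤ (f x - c) ^ 2 := fun x => by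
    rcases le_total (f x - c) 0 with h | h
    · rw [max_eq_right h, zero_pow two_ne_zero]; positivity
    · rw [max_eq_left h]
  have hb2 : ∀ x, max (c - f x) 0 ^ 2 ≤ (f x - c) ^ 2 := fun x => by
    rcases le_total (c - f x) 0 with h | h
    · rw [max_eq_right h, zero_pow two_ne_zero]; positivity
    · rw [max_eq_left h]; exact le_of_eq (by ring)
  have h1 := cheeger_nonneg hswap hmarg hκ hcond (u := fun x => max (f x - c) 0) (by fun_prop)
    (fun x => le_max_right _ _) (by simpa using hc1)
    (ne_top_of_le_ne_top hUfin (lintegral_mono fun x => ofReal_le_ofReal (hb1 x)))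
  have h2 := cheeger_nonneg hswap hmarg hκ hcond (u := fun x => max (c - f x) 0) (by fun_prop)
    (fun x => le_max_right _ _) (by simpa using hc2)
    (ne_top_of_le_ne_top hUfin (lintegral_mono fun x => ofReal_le_ofReal (hb2 x)))
  calc ENNReal.ofReal (κ ^ 2) * ∫⁻ x, ENNReal.ofReal (f x ^ 2) ∂μ
      ≤ ENNReal.ofReal (κ ^ 2) * ∫⁻ x, ENNReal.ofReal ((f x - c) ^ 2) ∂μ := by gcongr
    _ = ENNReal.ofReal (κ ^ 2) * ∫⁻ x, ENNReal.ofReal (max (f x - c) 0 ^ 2) ∂μ +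
        ENNReal.ofReal (κ ^ 2) * ∫⁻ x, ENNReal.ofReal (max (c - f x) 0 ^ 2) ∂μ := by
        rw [← mul_add, ← lintegral_add_left (by fun_prop)]
        congr 1
        refine lintegral_congr fun x => ?_
        rw [← ofReal_add (by positivity) (by positivity)]
        congr 1
        rcases le_total (f x) c with h | h
        · rw [max_eq_right (by linarith), max_eq_left (by linarith)]; ring
        · rw [max_eq_left (by linarith), max_eq_right (by linarith)]; ring
    _ ≤ _ := add_le_add h1 h2
    _ = ∫⁻ p, (ENNReal.ofReal ((max (f p.1 - c) 0 - max (f p.2 - c) 0) ^ 2) +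
        ENNReal.ofReal ((max (c - f p.1) 0 - max (c - f p.2) 0) ^ 2)) ∂m :=
        (lintegral_add_left (by fun_prop) _).symm
    _ ≤ _ := by
        refine lintegral_mono fun p => ?_
        simp only
        rw [← ofReal_add (by positivity) (by positivity)]
        refine ofReal_le_ofReal ?_
        generalize f p.1 = a
        generalize f p.2 = b
        rcases le_total a c with h | h <;> rcases le_total b c with h' | h'
        · rw [max_eq_right (by linarith), max_eq_right (by linarith), max_eq_left (by linarith),
            max_eq_left (by linarith)]
          exact le_of_eq (by ring)
        · rw [max_eq_right (by linarith), max_eq_left (by linarith), max_eq_left (by linarith),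
            max_eq_right (by linarith)]
          nlinarith [mul_nonneg (sub_nonneg.2 h) (sub_nonneg.2 h')]
        · rw [max_eq_left (by linarith), max_eq_right (by linarith), max_eq_right (by linarith),
            max_eq_left (by linarith)]
          nlinarith [mul_nonneg (sub_nonneg.2 h) (sub_nonneg.2 h')]
        · rw [max_eq_left (by linarith), max_eq_left (by linarith), max_eq_right (by linarith),
            max_eq_right (by linarith)]
          exact le_of_eq (by ring)

end Cheeger

lemma exp_le_tiltMass (s : ℝ) : exp (-((s / (2 + s)) ^ 2 * d / 2)) ≤ tiltMass d s := by
  have h : 1 + (s / (2 + s)) ^ 2 ≤ exp ((s / (2 + s)) ^ 2) := by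
    linarith [Real.add_one_le_exp ((s / (2 + s)) ^ 2)]
  calc exp (-((s / (2 + s)) ^ 2 * d / 2)) = exp ((s / (2 + s)) ^ 2) ^ (-(d : ℝ) / 2) := by
        rw [← Real.exp_mul]; ring_nf
    _ ≤ _ := Real.rpow_le_rpow_of_nonpos (by positivity) h (by
        have : (0 : ℝ) ≤ d := d.cast_nonneg
        linarith)

lemma slope_mul_sqrt_le {s : ℝ} (hs : 0 < s) :
    2 / (2 + s) / √(tiltVar s) * √(s * (2 + s)) ≤ 2 := by
  have hw := tiltVar_pos hs
  have hsw : 0 < √(tiltVar s) := sqrt_pos.2 hw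
  have h : √(s * (2 + s)) ≤ (2 + s) * √(tiltVar s) := by
    rw [sqrt_le_left (by positivity), mul_pow, sq_sqrt hw.le, tiltVar, mul_div_assoc',
      le_div_iff₀ (by positivity)]
    have : 0 ≤ s * (2 + s) * ((2 + s) ^ 2 - s ^ 2) := by
      have : (2 + s) ^ 2 - s ^ 2 = 4 + 4 * s := by ring
      rw [this]; positivity
    linarith
  calc 2 / (2 + s) / √(tiltVar s) * √(s * (2 + s))
      ≤ 2 / (2 + s) / √(tiltVar s) * ((2 + s) * √(tiltVar s)) := by gcongr
    _ = 2 := by field_simp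

lemma two_rpow_neg_nine_halves_le : (2 : ℝ) ^ (-(9 : ℝ) / 2) ≤ 0.0442 := by
  have h : ((2 : ℝ) ^ (-(9 : ℝ) / 2)) ^ 2 = 1 / 512 := by
    rw [← Real.rpow_natCast, ← Real.rpow_mul (by norm_num)]
    norm_num
  refine (sq_le_sq₀ (by positivity) (by norm_num)).1 ?_
  rw [h]; norm_num

lemma le_conductanceBound {d : ℕ} (hd : 1 ≤ d) {s : ℝ} (hs : 0 < s) :
    (2 : ℝ) ^ (-(9 : ℝ) / 2) * exp (-(s ^ 2 * d) / 8) * √(s * (2 + s)) * 0.3177765 ≤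
      conductanceBound d s := by
  have hd' : (1 : ℝ) ≤ d := by exact_mod_cast hd
  have hr := slope_mul_sqrt_le hs
  set r := 2 / (2 + s) / √(tiltVar s) with hrdef
  have hr0 : 0 ≤ r := by positivity
  have hsqrt : √(s * (2 + s)) ≤ s + 1 := by
    rw [sqrt_le_left (by positivity)]; nlinarith
  rw [conductanceBound, le_div_iff₀ (by positivity), ← hrdef]
  set D' := s ^ 2 / 8 - (s / (2 + s)) ^ 2 / 2 with hD'
  have hD'eq : D' = s ^ 3 * (4 + s) / (8 * (2 + s) ^ 2) := by
    rw [hD']; field_simp; ring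
  have hD'0 : 0 ≤ D' := by rw [hD'eq]; positivity
  have hpoly : 0.281 * (s + 2.5755) ≤ 1 + D' := by
    rw [hD'eq, ← sub_le_iff_le_add', le_div_iff₀ (by positivity)]
    nlinarith [sq_nonneg (s ^ 2 - 2), mul_nonneg hs.le (sq_nonneg (s - 1.4)),
      sq_nonneg (s - 0.85)]
  have hexp : 1 + D' ≤ exp (d * D') := by
    have := Real.add_one_le_exp (d * D')
    nlinarith
  have hK : (2 : ℝ) ^ (-(9 : ℝ) / 2) * √(s * (2 + s)) * 0.3177765 * (20 * (1 + π / 4 * r)) ≤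
      0.281 * (s + 2.5755) := by
    have e1 : √(s * (2 + s)) * (1 + π / 4 * r) ≤ s + 2.5755 := by
      have hpi : π / 4 * (r * √(s * (2 + s))) ≤ 3.151 / 4 * 2 := by
        gcongr
        linarith [Real.pi_lt_d2]
      linarith
    calc (2 : ℝ) ^ (-(9 : ℝ) / 2) * √(s * (2 + s)) * 0.3177765 * (20 * (1 + π / 4 * r))
        = (2 : ℝ) ^ (-(9 : ℝ) / 2) * (20 * 0.3177765) * (√(s * (2 + s)) * (1 + π / 4 * r)) := by
          ring
      _ ≤ 0.0442 * (20 * 0.3177765) * (s + 2.5755) := by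
          gcongr
          exact two_rpow_neg_nine_halves_le
      _ ≤ _ := by nlinarith
  calc (2 : ℝ) ^ (-(9 : ℝ) / 2) * exp (-(s ^ 2 * d) / 8) * √(s * (2 + s)) * 0.3177765 *
        (20 * (1 + π / 4 * r))
      = exp (-(s ^ 2 * d) / 8) * ((2 : ℝ) ^ (-(9 : ℝ) / 2) * √(s * (2 + s)) * 0.3177765 *
        (20 * (1 + π / 4 * r))) := by ring
    _ ≤ exp (-(s ^ 2 * d) / 8) * exp (d * D') := by
        gcongr
        exact hK.trans (hpoly.trans hexp)
    _ = exp (-((s / (2 + s)) ^ 2 * d / 2)) := by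
        rw [← Real.exp_add, hD']; ring_nf
    _ ≤ _ := exp_le_tiltMass s

/-- The stationary flow as a measure on pairs. -/
def flowMeasure (d : ℕ) (σ : ℝ) : Measure (Ed d × Ed d) :=
  (volume.prod volume).withDensity fun p => ENNReal.ofReal (lbFlow d σ p.1 p.2)

lemma flowMeasure_prod (σ : ℝ) {A B : Set (Ed d)} (hA : MeasurableSet A) (hB : MeasurableSet B) :
    flowMeasure d σ (A ×ˢ B) = setFlow d σ A B := by
  rw [flowMeasure, withDensity_apply _ (hA.prod hB), ← Measure.prod_restrict,
    lintegral_prod _ (measurable_lbFlow σ).ennreal_ofReal.aemeasurable, setFlow]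

lemma map_swap_flowMeasure {σ : ℝ} (hσ : 0 < σ) :
    (flowMeasure d σ).map Prod.swap = flowMeasure d σ := by
  ext s hs
  rw [Measure.map_apply measurable_swap hs, flowMeasure,
    withDensity_apply _ (measurable_swap hs), withDensity_apply _ hs,
    ← (Measure.measurePreserving_swap (μ := (volume : Measure (Ed d)))
      (ν := (volume : Measure (Ed d)))).setLIntegral_comp_preimage hs
      (measurable_lbFlow σ).ennreal_ofReal]
  simp only [Prod.fst_swap, Prod.snd_swap, lbFlow_comm hσ]

lemma map_fst_flowMeasure_le {σ : ℝ} (hσ : 0 < σ) :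
    (flowMeasure d σ).map Prod.fst ≤ piMeasure d := by
  refine Measure.le_iff.2 fun A hA => ?_
  rw [Measure.map_apply measurable_fst hA, ← Set.prod_univ, flowMeasure_prod σ hA .univ, setFlow,
    piMeasure_apply hA, Measure.restrict_univ]
  exact lintegral_mono fun x => lintegral_lbFlow_le hσ x

lemma lbDirichlet_eq (σ : ℝ) {f : Ed d → ℝ} (hf : Measurable f) :
    lbDirichlet d σ f =
      1 / 2 * ∫⁻ p, ENNReal.ofReal ((f p.1 - f p.2) ^ 2) ∂flowMeasure d σ := by
  have hm := (measurable_lbFlow (d := d) σ).ennreal_ofReal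
  have hg : Measurable fun p : Ed d × Ed d => ENNReal.ofReal ((f p.1 - f p.2) ^ 2) := by fun_prop
  rw [lbDirichlet, flowMeasure, lintegral_withDensity_eq_lintegral_mul _ hm hg,
    lintegral_prod _ (hm.mul hg).aemeasurable]
  congr 1
  refine lintegral_congr fun x => lintegral_congr fun y => ?_
  rw [Pi.mul_apply, mul_comm (ENNReal.ofReal _), ← ofReal_mul (sq_nonneg _), lbFlow]
  congr 1
  ring

instance (σ : ℝ) : SFinite (flowMeasure d σ) := by unfold flowMeasure; infer_instance

lemma ofReal_le_lbConductance {σ κ : ℝ} (hσ : 0 < σ) (hκ : κ ≤ conductanceBound d (σ ^ 2)) :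
    ENNReal.ofReal κ ≤ lbConductance d σ := by
  refine le_iInf₂ fun A hA => ?_
  obtain ⟨hA, h0, h2⟩ := hA
  rw [ENNReal.le_div_iff_mul_le (Or.inl h0.ne') (Or.inl (ne_top_of_le_ne_top (by simp) h2))]
  rw [← piMeasure_apply hA] at h2 ⊢
  exact (mul_le_mul_left (ofReal_le_ofReal hκ) _).trans (conductanceBound_mul_le_setFlow hσ hA h2)

lemma ofReal_le_lbGap {σ κ : ℝ} (hσ : 0 < σ) (hκ0 : 0 < κ)
    (hκ : κ ≤ conductanceBound d (σ ^ 2)) : ENNReal.ofReal (κ ^ 2 / 2) ≤ lbGap d σ := by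
  refine le_iInf₂ fun f hf => ?_
  obtain ⟨hf, h0, hfin, hmean⟩ := hf
  rw [ENNReal.le_div_iff_mul_le (Or.inl h0.ne') (Or.inl hfin.ne), lbDirichlet_eq σ hf]
  have h := cheeger (map_swap_flowMeasure hσ) (map_fst_flowMeasure_le hσ) hκ0
    (fun A hA h2 => by
      rw [flowMeasure_prod σ hA hA.compl]
      exact (mul_le_mul_left (ofReal_le_ofReal hκ) _).trans
        (conductanceBound_mul_le_setFlow hσ hA h2)) hf hfin hmean
  have e : ENNReal.ofReal (κ ^ 2 / 2) = 1 / 2 * ENNReal.ofReal (κ ^ 2) := by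
    rw [ofReal_div_of_pos two_pos, ofReal_ofNat, ENNReal.div_eq_inv_mul, one_div]
  rw [e, mul_assoc]
  gcongr

/-- Spectral gap and conductance lower bounds for the locally balanced ideal
kernel with `σ = ζ d^{-1/4}`. -/
theorem lb_ideal_gap_lower_bounds
    (d : ℕ) (hd : 1 ≤ d) (ζ : ℝ) (hζ : 0 < ζ) :
    ENNReal.ofReal
        ((2 : ℝ) ^ (-(9 : ℝ) / 2) * Real.exp (-ζ ^ 4 / 8) *
          Real.sqrt (ζ ^ 2 * (d : ℝ) ^ (-(1 : ℝ) / 2) *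
            (2 + ζ ^ 2 * (d : ℝ) ^ (-(1 : ℝ) / 2))) * 0.3177765) ≤
      lbConductance d (ζ * (d : ℝ) ^ (-(1 : ℝ) / 4)) ∧
    ENNReal.ofReal
        ((2 : ℝ) ^ (-(10 : ℝ)) * Real.exp (-ζ ^ 4 / 4) *
          (ζ ^ 2 * (d : ℝ) ^ (-(1 : ℝ) / 2) *
            (2 + ζ ^ 2 * (d : ℝ) ^ (-(1 : ℝ) / 2))) * 0.3177765 ^ 2) ≤
      lbGap d (ζ * (d : ℝ) ^ (-(1 : ℝ) / 4)) := by
  have hd0 : (0 : ℝ) < d := by exact_mod_cast hd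
  set σ := ζ * (d : ℝ) ^ (-(1 : ℝ) / 4) with hσdef
  have hσ : 0 < σ := by positivity
  have hs : ζ ^ 2 * (d : ℝ) ^ (-(1 : ℝ) / 2) = σ ^ 2 := by
    rw [hσdef, mul_pow, ← Real.rpow_natCast ((d : ℝ) ^ (-(1 : ℝ) / 4)), ← Real.rpow_mul hd0.le]
    norm_num
  have hζ4 : ζ ^ 4 = (σ ^ 2) ^ 2 * d := by
    have h : (d : ℝ) ^ (-(1 : ℝ) / 2) * (d : ℝ) ^ (-(1 : ℝ) / 2) * d = 1 := by
      rw [← Real.rpow_add hd0, show -(1 : ℝ) / 2 + -(1 : ℝ) / 2 = -1 by norm_num,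
        Real.rpow_neg_one, inv_mul_cancel₀ hd0.ne']
    rw [← hs]
    linear_combination -ζ ^ 4 * h
  have hκ := le_conductanceBound hd (s := σ ^ 2) (by positivity)
  rw [hs, hζ4]
  refine ⟨ofReal_le_lbConductance hσ hκ, ?_⟩
  clear_value σ
  refine le_trans (ofReal_le_ofReal (le_of_eq ?_)) (ofReal_le_lbGap hσ (by positivity) hκ)
  have h2 : ((2 : ℝ) ^ (-(9 : ℝ) / 2)) ^ 2 = 2 * (2 : ℝ) ^ (-(10 : ℝ)) := by
    rw [← Real.rpow_natCast, ← Real.rpow_mul (by norm_num)]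
    norm_num
  have h3 : exp (-((σ ^ 2) ^ 2 * d) / 8) ^ 2 = exp (-((σ ^ 2) ^ 2 * d) / 4) := by
    rw [← Real.exp_nat_mul]
    congr 1
    push_cast
    ring
  rw [mul_pow, mul_pow, mul_pow, h2, h3, sq_sqrt (by positivity)]
  ring

end
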